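/- arXiv:1805.10591 — 2 statements merged into one kernel-verified Lean document; each statement's English description precedes it below -/
import Mathlib

section
/- Let T be the closed triangle in ℝ² with vertices (0,0), (1,0), (0,1), and let q = (q₁, q₂) : ℝ² → ℝ² be continuously differentiable on a neighborhood of T. Suppose a, b, c ∈ ℝ are such that the field R(x₁,x₂) = (a + c·x₁, b + c·x₂) has the same edge integrals of the normal component as q on each of the three edges, i.e. ∫₀¹ (R₂ − q₂)(t, 0) dt = 0, ∫₀¹ (R₁ − q₁)(0, t) dt = 0, and ∫₀¹ ((R₁ − q₁) + (R₂ − q₂))(t, 1−t) dt = 0. Then ∫_T ‖q − R‖² dx ≤ (0.49294)² · ∫_T ((∂q₁/∂x₁)² + (∂q₁/∂x₂)² + (∂q₂/∂x₁)² + (∂q₂/∂x₂)²) dx. -/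
open MeasureTheory

open Set intervalIntegral

section OneDim

/-- Cauchy–Schwarz for the integral of a function against the constant `1`. -/
lemma sq_integral_le_mul_integral_sq {ψ : ℝ → ℝ} {a b : ℝ} (hab : a ≤ b)
    (h1 : IntervalIntegrable ψ volume a b) (h2 : IntervalIntegrable (fun x => ψ x ^ 2) volume a b) :
    (∫ x in a..b, ψ x) ^ 2 ≤ (b - a) * ∫ x in a..b, ψ x ^ 2 := by
  set I := ∫ x in a..b, ψ x with hI
  have key : 0 ≤ ∫ x in a..b, ((b - a) ^ 2 * ψ x ^ 2 - 2 * (b - a) * I * ψ x + I ^ 2) :=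
    intervalIntegral.integral_nonneg hab fun x _ => by nlinarith [sq_nonneg ((b - a) * ψ x - I)]
  rw [integral_add ((h2.const_mul _).sub (h1.const_mul _)) intervalIntegrable_const,
    integral_sub (h2.const_mul _) (h1.const_mul _), intervalIntegral.integral_const_mul,
    intervalIntegral.integral_const_mul,
    intervalIntegral.integral_const, smul_eq_mul, ← hI] at key
  rcases hab.eq_or_lt with rfl | hlt
  · simp [hI]
  · have : 0 ≤ (b - a) * ((b - a) * (∫ x in a..b, ψ x ^ 2) - I ^ 2) := by nlinarith
    have := nonneg_of_mul_nonneg_right this (sub_pos.2 hlt)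
    linarith

/-- An elementary Poincaré inequality on `[0, 1]`, for the variance of an absolutely continuous
function. -/
lemma variance_le_integral_sq_deriv {φ ψ : ℝ → ℝ} (hφ : Continuous φ)
    (h1 : IntervalIntegrable ψ volume 0 1) (h2 : IntervalIntegrable (fun x => ψ x ^ 2) volume 0 1)
    (hF : ∀ y z, 0 ≤ y → y ≤ z → z ≤ 1 → ∫ x in y..z, ψ x = φ z - φ y) :
    (∫ x in (0:ℝ)..1, φ x ^ 2) - (∫ x in (0:ℝ)..1, φ x) ^ 2 ≤
      1 / 8 * ∫ x in (0:ℝ)..1, ψ x ^ 2 := by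
  set k := φ (1 / 2) with hk
  have sub1 : ∀ {f : ℝ → ℝ}, IntervalIntegrable f volume 0 1 → ∀ y z, 0 ≤ y → y ≤ z → z ≤ 1 →
      IntervalIntegrable f volume y z := fun hf y z hy hyz hz =>
    hf.mono_set (by rw [uIcc_of_le hyz, uIcc_of_le zero_le_one]; exact Icc_subset_Icc hy hz)
  have cs : ∀ y z, 0 ≤ y → y ≤ z → z ≤ 1 →
      (φ z - φ y) ^ 2 ≤ (z - y) * ∫ x in y..z, ψ x ^ 2 := fun y z hy hyz hz => by
    rw [← hF y z hy hyz hz]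
    exact sq_integral_le_mul_integral_sq hyz (sub1 h1 y z hy hyz hz) (sub1 h2 y z hy hyz hz)
  have mono : ∀ y z y' z', 0 ≤ y' → y' ≤ y → y ≤ z → z ≤ z' → z' ≤ 1 →
      ∫ x in y..z, ψ x ^ 2 ≤ ∫ x in y'..z', ψ x ^ 2 := fun y z y' z' h0 hy hyz hz h1' =>
    integral_mono_interval hy hyz hz (Filter.Eventually.of_forall fun x => sq_nonneg _)
      (sub1 h2 y' z' h0 (hy.trans (hyz.trans hz)) h1')
  have up : ∫ z in (1 / 2 : ℝ)..1, (φ z - k) ^ 2 ≤ 1 / 8 * ∫ x in (1 / 2 : ℝ)..1, ψ x ^ 2 := by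
    calc ∫ z in (1 / 2 : ℝ)..1, (φ z - k) ^ 2
        ≤ ∫ z in (1 / 2 : ℝ)..1, (z - 1 / 2) * ∫ x in (1 / 2 : ℝ)..1, ψ x ^ 2 := by
          refine integral_mono_on (by norm_num) (Continuous.intervalIntegrable (by fun_prop) _ _)
            (Continuous.intervalIntegrable (by fun_prop) _ _) fun z hz => ?_
          exact (cs _ z (by norm_num) hz.1 hz.2).trans (mul_le_mul_of_nonneg_left
            (mono _ _ _ _ (by norm_num) le_rfl hz.1 hz.2 le_rfl) (by linarith [hz.1]))
      _ = _ := by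
          rw [intervalIntegral.integral_mul_const,
            intervalIntegral.integral_sub (by simp) (by simp),
            integral_id, intervalIntegral.integral_const]
          norm_num
  have down : ∫ z in (0 : ℝ)..1 / 2, (φ z - k) ^ 2 ≤ 1 / 8 * ∫ x in (0 : ℝ)..1 / 2, ψ x ^ 2 := by
    calc ∫ z in (0 : ℝ)..1 / 2, (φ z - k) ^ 2
        ≤ ∫ z in (0 : ℝ)..1 / 2, (1 / 2 - z) * ∫ x in (0 : ℝ)..1 / 2, ψ x ^ 2 := by
          refine integral_mono_on (by norm_num) (Continuous.intervalIntegrable (by fun_prop) _ _)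
            (Continuous.intervalIntegrable (by fun_prop) _ _) fun z hz => ?_
          rw [← neg_sub, neg_sq]
          exact (cs z _ hz.1 hz.2 (by norm_num)).trans (mul_le_mul_of_nonneg_left
            (mono _ _ _ _ le_rfl hz.1 hz.2 le_rfl (by norm_num)) (by linarith [hz.2]))
      _ = _ := by
          rw [intervalIntegral.integral_mul_const,
            intervalIntegral.integral_sub (by simp) (by simp),
            integral_id, intervalIntegral.integral_const]
          norm_num
  have tot : ∫ z in (0 : ℝ)..1, (φ z - k) ^ 2 ≤ 1 / 8 * ∫ x in (0 : ℝ)..1, ψ x ^ 2 := by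
    rw [← integral_add_adjacent_intervals (b := 1 / 2)
      (sub1 h2 _ _ le_rfl (by norm_num) (by norm_num))
      (sub1 h2 _ _ (by norm_num) (by norm_num) le_rfl),
      ← integral_add_adjacent_intervals (b := 1 / 2)
      (Continuous.intervalIntegrable (by fun_prop) _ _)
      (Continuous.intervalIntegrable (by fun_prop) _ _)]
    linarith
  have ex : ∫ z in (0 : ℝ)..1, (φ z - k) ^ 2 =
      (∫ x in (0:ℝ)..1, φ x ^ 2) - 2 * k * (∫ x in (0:ℝ)..1, φ x) + k ^ 2 := by
    have : ∀ z, (φ z - k) ^ 2 = φ z ^ 2 - 2 * k * φ z + k ^ 2 := fun z => by ring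
    simp only [this]
    rw [integral_add (Continuous.intervalIntegrable (by fun_prop) _ _) (by simp),
      integral_sub (Continuous.intervalIntegrable (by fun_prop) _ _)
      (Continuous.intervalIntegrable (by fun_prop) _ _), intervalIntegral.integral_const_mul,
      intervalIntegral.integral_const]
    simp
  nlinarith [sq_nonneg ((∫ x in (0:ℝ)..1, φ x) - k)]

end OneDim

section Square

/-- Fubini for continuous functions on a square. -/
lemma integral_integral_swap_of_continuous {f : ℝ → ℝ → ℝ} (hf : Continuous (Function.uncurry f)) :
    ∫ x in (0:ℝ)..1, ∫ y in (0:ℝ)..1, f x y = ∫ y in (0:ℝ)..1, ∫ x in (0:ℝ)..1, f x y := by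
  simp only [integral_of_le zero_le_one]
  refine integral_integral_swap ?_
  rw [Measure.prod_restrict]
  exact (hf.continuousOn.integrableOn_compact (isCompact_Icc.prod isCompact_Icc)).mono_set
    (prod_mono Ioc_subset_Icc_self Ioc_subset_Icc_self)

/-- For a function on the unit square with zero mean that is symmetric about the antidiagonal, the
variance of the row averages is at most half of the total variance. -/
lemma two_mul_integral_sq_mean_le {V : ℝ → ℝ → ℝ} (hV : Continuous (Function.uncurry V))
    (hsymm : ∀ x y, V (1 - y) (1 - x) = V x y)
    (h0 : ∫ x in (0:ℝ)..1, ∫ y in (0:ℝ)..1, V x y = 0) :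
    2 * ∫ x in (0:ℝ)..1, (∫ y in (0:ℝ)..1, V x y) ^ 2 ≤
      ∫ x in (0:ℝ)..1, ∫ y in (0:ℝ)..1, V x y ^ 2 := by
  set m : ℝ → ℝ := fun x => ∫ y in (0:ℝ)..1, V x y with hm
  have hmc : Continuous m := continuous_parametric_intervalIntegral_of_continuous' hV 0 1
  have hV2 : Continuous (Function.uncurry fun x y => V x y ^ 2) :=
    hV.pow 2
  have hVm : Continuous (Function.uncurry fun x y => V x y * m (1 - y)) :=
    hV.mul (hmc.comp (by fun_prop))
  have hVx : ∀ x, Continuous (V x) := fun x => hV.comp (by fun_prop : Continuous fun y => (x, y))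
  have hcol : ∀ y, ∫ x in (0:ℝ)..1, V x y = m (1 - y) := fun y => by
    have := integral_comp_sub_left (a := 0) (b := 1) (fun s => V (1 - y) s) 1
    simp only [hsymm] at this
    simpa using this
  have hflip : ∀ f : ℝ → ℝ, ∫ y in (0:ℝ)..1, f (1 - y) = ∫ y in (0:ℝ)..1, f y := fun f => by
    simp
  have hcross : ∫ x in (0:ℝ)..1, ∫ y in (0:ℝ)..1, V x y * m (1 - y) =
      ∫ x in (0:ℝ)..1, m x ^ 2 := by
    rw [integral_integral_swap_of_continuous hVm]
    simp only [intervalIntegral.integral_mul_const, hcol, ← sq]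
    exact hflip fun y => m y ^ 2
  have key : 0 ≤ ∫ x in (0:ℝ)..1, ∫ y in (0:ℝ)..1, (V x y - m x - m (1 - y)) ^ 2 :=
    integral_nonneg zero_le_one fun x _ => integral_nonneg zero_le_one fun y _ => sq_nonneg _
  have inner : ∀ x, ∫ y in (0:ℝ)..1, (V x y - m x - m (1 - y)) ^ 2 =
      (∫ y in (0:ℝ)..1, V x y ^ 2) - 2 * (∫ y in (0:ℝ)..1, V x y * m (1 - y)) - m x ^ 2
        + ∫ y in (0:ℝ)..1, m y ^ 2 := fun x => by
    have e : ∀ y, (V x y - m x - m (1 - y)) ^ 2 = V x y ^ 2 - 2 * (V x y * m (1 - y))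
      - 2 * m x * V x y + m x ^ 2 + 2 * m x * m (1 - y) + m (1 - y) ^ 2 := fun y => by ring
    have c1 := hVx x
    have cc : ∀ {f : ℝ → ℝ}, Continuous f → IntervalIntegrable f volume 0 1 :=
      fun h => h.intervalIntegrable _ _
    simp only [e]
    rw [integral_add (cc (by fun_prop)) (cc (by fun_prop)),
      integral_add (cc (by fun_prop)) (cc (by fun_prop)),
      integral_add (cc (by fun_prop)) (cc (by fun_prop)),
      integral_sub (cc (by fun_prop)) (cc (by fun_prop)),
      integral_sub (cc (by fun_prop)) (cc (by fun_prop)),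
      intervalIntegral.integral_const_mul, intervalIntegral.integral_const_mul,
      intervalIntegral.integral_const_mul, intervalIntegral.integral_const,
      hflip m, hflip fun y => m y ^ 2, h0]
    change _ - _ - 2 * m x * m x + _ + _ + _ = _
    simp
    ring
  have k1 : Continuous fun x => ∫ y in (0:ℝ)..1, V x y ^ 2 :=
    continuous_parametric_intervalIntegral_of_continuous' hV2 0 1
  have k2 : Continuous fun x => ∫ y in (0:ℝ)..1, V x y * m (1 - y) :=
    continuous_parametric_intervalIntegral_of_continuous' hVm 0 1
  have cc : ∀ {f : ℝ → ℝ}, Continuous f → IntervalIntegrable f volume 0 1 :=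
    fun h => h.intervalIntegrable _ _
  simp only [inner] at key
  rw [integral_add (cc (by fun_prop)) (cc (by fun_prop)),
    integral_sub (cc (by fun_prop)) (cc (by fun_prop)),
    integral_sub (cc (by fun_prop)) (cc (by fun_prop)),
    intervalIntegral.integral_const_mul, intervalIntegral.integral_const, hcross] at key
  simp only [sub_zero, one_smul] at key
  linarith

end Square

/-- The reciprocal of `0.49294` lies just below the first positive root of `tan ω = -ω`. -/
lemma sin_add_mul_cos_nonneg :
    (0:ℝ) ≤ Real.sin (1 / 0.49294) + (1 / 0.49294) * Real.cos (1 / 0.49294) := by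
  obtain ⟨ω, hω⟩ : ∃ ω : ℝ, ω = 1 / 0.49294 := ⟨_, rfl⟩
  rw [← hω]
  have hs := Real.sin_bound (x := ω / 16) (by rw [abs_le]; constructor <;> norm_num [hω])
  rw [abs_of_nonneg (show (0:ℝ) ≤ ω / 16 by norm_num [hω])] at hs
  have h0 : Real.sin (ω / 16) ≤ 0.126451 := by
    have := (abs_le.1 hs).2
    norm_num [hω] at this ⊢
    linarith
  have h0' : 0 ≤ Real.sin (ω / 16) :=
    Real.sin_nonneg_of_nonneg_of_le_pi (by norm_num [hω])
      (le_trans (by norm_num [hω]) Real.pi_gt_three.le)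
  have h1 : 0.96802 ≤ Real.cos (ω / 8) := by
    have e : ω / 8 = 2 * (ω / 16) := by ring
    rw [e, Real.cos_two_mul, Real.cos_sq']
    nlinarith
  have h2 : 0.874125 ≤ Real.cos (ω / 4) := by
    have e : ω / 4 = 2 * (ω / 8) := by ring
    rw [e, Real.cos_two_mul]
    nlinarith
  have h3 : 0.528188 ≤ Real.cos (ω / 2) := by
    have e : ω / 2 = 2 * (ω / 4) := by ring
    rw [e, Real.cos_two_mul]
    nlinarith
  have h4 : -0.44213 ≤ Real.cos ω := by
    have e : ω = 2 * (ω / 2) := by ring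
    rw [e, Real.cos_two_mul]
    nlinarith
  have hsin : 0 ≤ Real.sin ω := Real.sin_nonneg_of_nonneg_of_le_pi (by norm_num [hω])
    (le_trans (by norm_num [hω]) Real.pi_gt_three.le)
  rcases le_total 0 (Real.cos ω) with hc | hc
  · have : 0 ≤ ω := by norm_num [hω]
    positivity
  · have hsq : (ω * -Real.cos ω) ^ 2 ≤ Real.sin ω ^ 2 := by
      rw [Real.sin_sq]
      have hω2 : ω ^ 2 ≤ 4.1154 := by norm_num [hω]
      have hc2 : Real.cos ω ^ 2 ≤ 0.44213 ^ 2 := sq_le_sq' h4 (hc.trans (by norm_num))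
      have := mul_le_mul_of_nonneg_right hω2 (sq_nonneg (Real.cos ω))
      rw [mul_pow, neg_sq]
      linarith
    have := abs_le_of_sq_le_sq hsq hsin
    linarith [le_abs_self (ω * -Real.cos ω)]

section Triangle

/-- The closed unit right isosceles triangle with vertices `(0, 0)`, `(1, 0)` and `(0, 1)`. -/
def unitTriangle : Set (ℝ × ℝ) := {p | 0 ≤ p.1 ∧ 0 ≤ p.2 ∧ p.1 + p.2 ≤ 1}

lemma convexHull_eq_unitTriangle :
    convexHull ℝ {((0 : ℝ), (0 : ℝ)), (1, 0), (0, 1)} = unitTriangle := by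
  apply Subset.antisymm
  · refine convexHull_min ?_ ?_
    · rintro p (rfl | rfl | rfl) <;> norm_num [unitTriangle]
    · rintro ⟨a, b⟩ ⟨h1, h2, h3⟩ ⟨c, d⟩ ⟨h4, h5, h6⟩ s t hs ht hst
      simp only [unitTriangle, mem_ofPred_eq, Prod.smul_mk, Prod.mk_add_mk, smul_eq_mul] at *
      refine ⟨by positivity, by positivity, ?_⟩
      nlinarith [mul_le_mul_of_nonneg_left h3 hs, mul_le_mul_of_nonneg_left h6 ht]
  · rintro ⟨x, y⟩ ⟨h1, h2, h3⟩
    simp only at h1 h2 h3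
    rw [convexHull_insert (by simp), mem_convexJoin]
    rw [convexHull_pair]
    have hx : (0 : ℝ × ℝ) ∈ ({(0, 0)} : Set (ℝ × ℝ)) := rfl
    refine ⟨0, hx, ?_⟩
    rcases (add_nonneg h1 h2).eq_or_lt with h | h
    · exact ⟨(1, 0), left_mem_segment _ _ _, by
        obtain rfl : x = 0 := by linarith
        obtain rfl : y = 0 := by linarith
        exact left_mem_segment _ _ _⟩
    · refine ⟨(x / (x + y), y / (x + y)), ⟨x / (x + y), y / (x + y), by positivity, by positivity,
        by field_simp, by simp⟩, 1 - (x + y), x + y, by linarith, h.le, by ring, ?_⟩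
      simp only [smul_zero, zero_add, Prod.smul_mk, smul_eq_mul, Prod.mk.injEq]
      constructor <;> field_simp

lemma isClosed_unitTriangle : IsClosed unitTriangle :=
  ((isClosed_le continuous_const continuous_fst).inter
    ((isClosed_le continuous_const continuous_snd).inter
      (isClosed_le (continuous_fst.add continuous_snd) continuous_const)))

lemma unitTriangle_subset_Icc : unitTriangle ⊆ Icc 0 1 := fun p hp =>
  ⟨⟨hp.1, hp.2.1⟩, ⟨by simpa using by linarith [hp.2.1, hp.2.2], by
    simpa using by linarith [hp.1, hp.2.2]⟩⟩

lemma isCompact_unitTriangle : IsCompact unitTriangle :=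
  isCompact_Icc.of_isClosed_subset isClosed_unitTriangle unitTriangle_subset_Icc

lemma Continuous.integrableOn_unitTriangle {f : ℝ × ℝ → ℝ} (hf : Continuous f) :
    IntegrableOn f unitTriangle :=
  hf.continuousOn.integrableOn_compact isCompact_unitTriangle

lemma setIntegral_unitTriangle_swap (f : ℝ × ℝ → ℝ) :
    ∫ p in unitTriangle, f p.swap = ∫ p in unitTriangle, f p := by
  have e : Prod.swap ⁻¹' unitTriangle = unitTriangle := by
    ext p
    simp only [unitTriangle, mem_preimage, mem_ofPred_eq, Prod.fst_swap, Prod.snd_swap]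
    rw [add_comm]
    tauto
  have := (Measure.measurePreserving_swap (μ := (volume : Measure ℝ))
    (ν := (volume : Measure ℝ))).setIntegral_preimage_emb
    MeasurableEquiv.prodComm.measurableEmbedding f unitTriangle
  rw [e] at this
  exact this

lemma setIntegral_unitTriangle {f : ℝ × ℝ → ℝ} (hf : Continuous f) :
    ∫ p in unitTriangle, f p = ∫ x in (0:ℝ)..1, ∫ y in (0:ℝ)..(1 - x), f (x, y) := by
  have hm := isClosed_unitTriangle.measurableSet
  rw [← MeasureTheory.integral_indicator hm, Measure.volume_eq_prod, integral_prod _ (by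
    rw [← Measure.volume_eq_prod, integrable_indicator_iff hm]
    exact hf.integrableOn_unitTriangle), integral_of_le zero_le_one, ← integral_Icc_eq_integral_Ioc,
    ← MeasureTheory.integral_indicator measurableSet_Icc]
  congr 1
  ext x
  by_cases hx : x ∈ Icc (0:ℝ) 1
  · rw [indicator_of_mem hx, integral_of_le (by linarith [hx.2]), ← integral_Icc_eq_integral_Ioc,
      ← MeasureTheory.integral_indicator measurableSet_Icc]
    congr 1
    ext y
    simp only [indicator, unitTriangle, mem_ofPred_eq, mem_Icc]
    congr 1
    refine propext ⟨fun h => ⟨h.2.1, by linarith [h.2.2]⟩, fun h => ⟨hx.1, h.1, by linarith [h.2]⟩⟩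
  · rw [indicator_of_notMem hx]
    have : ∀ y, unitTriangle.indicator f (x, y) = 0 := fun y =>
      indicator_of_notMem (fun h => hx ⟨h.1, by linarith [h.2.1, h.2.2]⟩) _
    simp [this]

lemma setIntegral_unitTriangle' {f : ℝ × ℝ → ℝ} (hf : Continuous f) :
    ∫ p in unitTriangle, f p = ∫ y in (0:ℝ)..1, ∫ x in (0:ℝ)..(1 - y), f (x, y) := by
  rw [← setIntegral_unitTriangle_swap,
    setIntegral_unitTriangle (f := fun p => f p.swap) (hf.comp continuous_swap)]
  rfl

/-- The antidiagonal reflection of the rows of the unit square splits an integral into two integrals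
over the triangle. -/
lemma integral_rows_eq {f g : ℝ × ℝ → ℝ} (hf : Continuous f) (hg : Continuous g) :
    ∫ x in (0:ℝ)..1, ((∫ y in (0:ℝ)..(1 - x), f (x, y)) + ∫ y in (1 - x)..1, g (1 - y, 1 - x)) =
      (∫ p in unitTriangle, f p) + ∫ p in unitTriangle, g p := by
  have e : ∀ x, ∫ y in (1 - x)..1, g (1 - y, 1 - x) = ∫ s in (0:ℝ)..x, g (s, 1 - x) := fun x => by
    rw [integral_comp_sub_left (fun s => g (s, 1 - x)) 1]
    simp
  simp only [e]
  have cf : Continuous fun x => ∫ y in (0:ℝ)..(1 - x), f (x, y) :=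
    continuous_parametric_intervalIntegral_of_continuous (f := fun x y => f (x, y))
      (hf.comp (by fun_prop)) (by fun_prop)
  have cg : Continuous fun x => ∫ s in (0:ℝ)..x, g (s, 1 - x) :=
    continuous_parametric_intervalIntegral_of_continuous (f := fun x s => g (s, 1 - x))
      (hg.comp (by fun_prop)) continuous_id
  rw [intervalIntegral.integral_add (cf.intervalIntegrable _ _) (cg.intervalIntegrable _ _),
    setIntegral_unitTriangle hf, setIntegral_unitTriangle' hg]
  congr 1
  have := integral_comp_sub_left (a := 0) (b := 1) (fun x => ∫ s in (0:ℝ)..x, g (s, 1 - x)) 1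
  simp only [sub_sub_cancel, sub_self, sub_zero] at this
  exact this.symm

lemma intervalIntegrable_ite {f g : ℝ → ℝ} (hf : Continuous f) (hg : Continuous g) {c : ℝ}
    (hc : c ∈ Icc (0:ℝ) 1) :
    IntervalIntegrable (fun y => if y ≤ c then f y else g y) volume 0 1 := by
  refine IntervalIntegrable.trans (b := c) ?_ ?_
  · refine (hf.intervalIntegrable 0 c).congr fun y hy => ?_
    rw [uIoc_of_le hc.1] at hy
    simp [hy.2]
  · refine (hg.intervalIntegrable c 1).congr fun y hy => ?_
    rw [uIoc_of_le hc.2] at hy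
    simp [hy.1]

lemma integral_ite_le {f g : ℝ → ℝ} (hf : Continuous f) (hg : Continuous g) {c : ℝ}
    (hc : c ∈ Icc (0:ℝ) 1) :
    ∫ y in (0:ℝ)..1, (if y ≤ c then f y else g y) = (∫ y in (0:ℝ)..c, f y) + ∫ y in c..1, g y := by
  have hi := intervalIntegrable_ite hf hg hc
  rw [← integral_add_adjacent_intervals (b := c)
    (hi.mono_set (by
      rw [uIcc_of_le hc.1, uIcc_of_le zero_le_one]
      exact Icc_subset_Icc le_rfl hc.2))
    (hi.mono_set (by
      rw [uIcc_of_le hc.2, uIcc_of_le zero_le_one]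
      exact Icc_subset_Icc hc.1 le_rfl))]
  congr 1
  · refine integral_congr_ae (Filter.Eventually.of_forall fun y hy => ?_)
    rw [uIoc_of_le hc.1] at hy
    simp [hy.2]
  · refine integral_congr_ae (Filter.Eventually.of_forall fun y hy => ?_)
    rw [uIoc_of_le hc.2] at hy
    simp [hy.1]

/-- Reflection of the unit square onto the triangle across the antidiagonal. -/
def foldSquare (x y : ℝ) : ℝ × ℝ := (min x (1 - y), min y (1 - x))

lemma foldSquare_eq_ite (x y : ℝ) :
    foldSquare x y = if y ≤ 1 - x then (x, y) else (1 - y, 1 - x) := by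
  unfold foldSquare
  split_ifs with h
  · rw [min_eq_left h, min_eq_left (by linarith)]
  · rw [min_eq_right (by linarith), min_eq_right (by linarith)]

lemma integral_foldSquare {f : ℝ × ℝ → ℝ} (hf : Continuous f) :
    ∫ x in (0:ℝ)..1, ∫ y in (0:ℝ)..1, f (foldSquare x y) = 2 * ∫ p in unitTriangle, f p := by
  rw [two_mul, ← integral_rows_eq hf hf]
  refine integral_congr fun x hx => ?_
  rw [uIcc_of_le zero_le_one] at hx
  simp only [foldSquare_eq_ite, apply_ite f]
  exact integral_ite_le (f := fun y => f (x, y)) (g := fun y => f (1 - y, 1 - x))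
    (hf.comp (by fun_prop)) (hf.comp (by fun_prop))
    ⟨by linarith [hx.2], by linarith [hx.1]⟩

/-- `v` is continuously differentiable on the plane, with partial derivatives `vx` and `vy`. -/
structure HasContinuousPartials (v vx vy : ℝ × ℝ → ℝ) : Prop where
  continuous : Continuous v
  continuous_fst : Continuous vx
  continuous_snd : Continuous vy
  hasDerivAt_fst : ∀ x y, HasDerivAt (fun s => v (s, y)) (vx (x, y)) x
  hasDerivAt_snd : ∀ x y, HasDerivAt (fun s => v (x, s)) (vy (x, y)) y

namespace HasContinuousPartials

variable {v vx vy w wx wy : ℝ × ℝ → ℝ}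

lemma add_const_mul (hv : HasContinuousPartials v vx vy) (hw : HasContinuousPartials w wx wy)
    (t : ℝ) : HasContinuousPartials (fun p => v p + t * w p) (fun p => vx p + t * wx p)
      (fun p => vy p + t * wy p) where
  continuous := hv.1.add (hw.1.const_mul t)
  continuous_fst := hv.2.add (hw.2.const_mul t)
  continuous_snd := hv.3.add (hw.3.const_mul t)
  hasDerivAt_fst x y := (hv.4 x y).add ((hw.4 x y).const_mul t)
  hasDerivAt_snd x y := (hv.5 x y).add ((hw.5 x y).const_mul t)

lemma comp_swap (hv : HasContinuousPartials v vx vy) :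
    HasContinuousPartials (fun p => v p.swap) (fun p => vy p.swap) (fun p => vx p.swap) where
  continuous := hv.1.comp continuous_swap
  continuous_fst := hv.3.comp continuous_swap
  continuous_snd := hv.2.comp continuous_swap
  hasDerivAt_fst x y := hv.5 y x
  hasDerivAt_snd x y := hv.4 y x

lemma setIntegral_fst (hv : HasContinuousPartials v vx vy) :
    ∫ p in unitTriangle, vx p =
      (∫ y in (0:ℝ)..1, v (1 - y, y)) - ∫ y in (0:ℝ)..1, v (0, y) := by
  have c := hv.1
  have c1 := hv.2
  rw [setIntegral_unitTriangle' hv.2, ← intervalIntegral.integral_sub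
    (Continuous.intervalIntegrable (by fun_prop) _ _)
    (Continuous.intervalIntegrable (by fun_prop) _ _)]
  refine integral_congr fun y _ => ?_
  exact integral_eq_sub_of_hasDerivAt (fun x _ => hv.4 x y)
    (Continuous.intervalIntegrable (by fun_prop) _ _)

lemma setIntegral_snd (hv : HasContinuousPartials v vx vy) :
    ∫ p in unitTriangle, vy p =
      (∫ x in (0:ℝ)..1, v (x, 1 - x)) - ∫ x in (0:ℝ)..1, v (x, 0) := by
  rw [← setIntegral_unitTriangle_swap]
  exact hv.comp_swap.setIntegral_fst

/-- An elementary Poincaré inequality on the triangle. -/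
lemma poincare (hv : HasContinuousPartials v vx vy) (h0 : ∫ p in unitTriangle, v p = 0) :
    8 * ∫ p in unitTriangle, v p ^ 2 ≤ ∫ p in unitTriangle, (vx p ^ 2 + vy p ^ 2) := by
  have c := hv.1
  have c1 := hv.2
  have c2 := hv.3
  have hV : Continuous (Function.uncurry fun x y => v (foldSquare x y)) := by
    have : Continuous fun p : ℝ × ℝ => v (foldSquare p.1 p.2) := by
      unfold foldSquare
      fun_prop
    exact this
  have hV2 : Continuous (Function.uncurry fun x y => v (foldSquare x y) ^ 2) := hV.pow 2
  have mean := two_mul_integral_sq_mean_le hV (fun x y => by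
    congr 1
    simp only [foldSquare, sub_sub_cancel]
    rw [min_comm, min_comm (1 - x)]) (by rw [integral_foldSquare hv.1, h0, mul_zero])
  rw [integral_foldSquare (f := fun p => v p ^ 2) (by fun_prop)] at mean
  have row : ∀ x ∈ Icc (0:ℝ) 1, (∫ y in (0:ℝ)..1, v (foldSquare x y) ^ 2) -
      (∫ y in (0:ℝ)..1, v (foldSquare x y)) ^ 2 ≤ 1 / 8 *
      ((∫ y in (0:ℝ)..(1 - x), vy (x, y) ^ 2) + ∫ y in (1 - x)..1, vx (1 - y, 1 - x) ^ 2) := by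
    intro x hx
    have hx' : 1 - x ∈ Icc (0:ℝ) 1 := ⟨by linarith [hx.2], by linarith [hx.1]⟩
    have hφ : Continuous fun y => v (foldSquare x y) := by
      unfold foldSquare
      fun_prop
    have i1 := intervalIntegrable_ite (f := fun y => vy (x, y)) (g := fun y => -vx (1 - y, 1 - x))
      (by fun_prop) (by fun_prop) hx'
    have sqe : ∀ y, (if y ≤ 1 - x then vy (x, y) else -vx (1 - y, 1 - x)) ^ 2 =
        if y ≤ 1 - x then vy (x, y) ^ 2 else vx (1 - y, 1 - x) ^ 2 := fun y => by
      split_ifs <;> simp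
    have i2 := intervalIntegrable_ite (f := fun y => vy (x, y) ^ 2)
      (g := fun y => vx (1 - y, 1 - x) ^ 2) (by fun_prop) (by fun_prop) hx'
    have := variance_le_integral_sq_deriv hφ i1 (by simpa only [sqe] using i2) ?_
    · simp only [sqe] at this
      rwa [integral_ite_le (f := fun y => vy (x, y) ^ 2) (g := fun y => vx (1 - y, 1 - x) ^ 2)
        (by fun_prop) (by fun_prop) hx'] at this
    · intro y z hy hyz hz
      refine integral_eq_of_hasDerivAt_off_countable_of_le (fun y => v (foldSquare x y)) _ hyz
        (countable_singleton (1 - x)) hφ.continuousOn ?_ (i1.mono_set (by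
          rw [uIcc_of_le hyz, uIcc_of_le zero_le_one]; exact Icc_subset_Icc hy hz))
      rintro s ⟨-, hs⟩
      rcases lt_or_gt_of_ne (show s ≠ 1 - x from hs) with h | h
      · rw [if_pos h.le]
        refine (hv.5 x s).congr_of_eventuallyEq ?_
        filter_upwards [gt_mem_nhds h] with r hr
        rw [foldSquare_eq_ite, if_pos hr.le]
      · rw [if_neg (not_le.2 h)]
        have d : HasDerivAt (fun r => v (1 - r, 1 - x)) (-vx (1 - s, 1 - x)) s := by
          have := (hv.4 (1 - s) (1 - x)).comp s ((hasDerivAt_id s).const_sub 1)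
          rw [mul_neg_one] at this
          exact this
        refine d.congr_of_eventuallyEq ?_
        filter_upwards [lt_mem_nhds h] with r hr
        rw [foldSquare_eq_ite, if_neg (not_le.2 hr)]
  have k1 : Continuous fun x => ∫ y in (0:ℝ)..1, v (foldSquare x y) ^ 2 :=
    continuous_parametric_intervalIntegral_of_continuous' hV2 0 1
  have k2 : Continuous fun x => ∫ y in (0:ℝ)..1, v (foldSquare x y) :=
    continuous_parametric_intervalIntegral_of_continuous' hV 0 1
  have k3 : Continuous fun x => ∫ y in (0:ℝ)..(1 - x), vy (x, y) ^ 2 :=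
    continuous_parametric_intervalIntegral_of_continuous (f := fun x y => vy (x, y) ^ 2)
      (by unfold Function.uncurry; fun_prop) (by fun_prop)
  have k4 : Continuous fun x => ∫ y in (1 - x)..1, vx (1 - y, 1 - x) ^ 2 := by
    simp only [fun x : ℝ => integral_symm (μ := volume)
      (f := fun y => vx (1 - y, 1 - x) ^ 2) (1 : ℝ) (1 - x)]
    exact (continuous_parametric_intervalIntegral_of_continuous
      (f := fun x y => vx (1 - y, 1 - x) ^ 2)
      (by unfold Function.uncurry; fun_prop) (by fun_prop)).neg
  have tot := integral_mono_on (μ := volume) zero_le_one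
    (Continuous.intervalIntegrable (by fun_prop) _ _)
    (Continuous.intervalIntegrable (by fun_prop) _ _) row
  rw [intervalIntegral.integral_sub (Continuous.intervalIntegrable (by fun_prop) _ _)
      (Continuous.intervalIntegrable (by fun_prop) _ _),
    intervalIntegral.integral_const_mul, integral_foldSquare (f := fun p => v p ^ 2) (by fun_prop),
    integral_rows_eq (f := fun p => vy p ^ 2) (g := fun p => vx p ^ 2) (by fun_prop) (by fun_prop)]
    at tot
  rw [integral_add (Continuous.integrableOn_unitTriangle (by fun_prop))
    (Continuous.integrableOn_unitTriangle (by fun_prop))]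
  linarith

/-- The function `cos (ω (1 - x)) + cos (ω y)`, which for the critical `ω` is extremal among the
functions on the triangle with zero mean over the edge `x = 0`. -/
noncomputable def edgeMode (ω : ℝ) (p : ℝ × ℝ) : ℝ :=
  Real.cos (ω * (1 - p.1)) + Real.cos (ω * p.2)

lemma edgeMode_partials (ω : ℝ) : HasContinuousPartials (edgeMode ω)
    (fun p => ω * Real.sin (ω * (1 - p.1))) (fun p => -(ω * Real.sin (ω * p.2))) where
  continuous := by unfold edgeMode; fun_prop
  continuous_fst := by fun_prop
  continuous_snd := by fun_prop
  hasDerivAt_fst x y := by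
    have := ((((hasDerivAt_id x).const_sub 1).const_mul ω).cos).add_const (Real.cos (ω * y))
    exact this.congr_deriv (by dsimp only [id]; ring)
  hasDerivAt_snd x y := by
    have := ((((hasDerivAt_id y).const_mul ω).cos)).const_add (Real.cos (ω * (1 - x)))
    exact this.congr_deriv (by dsimp only [id]; ring)

/-- Green's formula against `edgeMode ω`: only the boundary term over the edge `x = 0` survives. -/
lemma green_edgeMode (hv : HasContinuousPartials v vx vy) (ω : ℝ) :
    ∫ p in unitTriangle, (vx p * (ω * Real.sin (ω * (1 - p.1))) +
      vy p * -(ω * Real.sin (ω * p.2)) - ω ^ 2 * (v p * edgeMode ω p)) =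
      -(ω * Real.sin ω) * ∫ y in (0:ℝ)..1, v (0, y) := by
  have c := hv.1
  have c1 := hv.2
  have c2 := hv.3
  have h1 : HasContinuousPartials (fun p => v p * (ω * Real.sin (ω * (1 - p.1))))
      (fun p => vx p * (ω * Real.sin (ω * (1 - p.1))) +
        v p * -(ω ^ 2 * Real.cos (ω * (1 - p.1))))
      (fun p => vy p * (ω * Real.sin (ω * (1 - p.1)))) :=
    { continuous := by fun_prop
      continuous_fst := by fun_prop
      continuous_snd := by fun_prop
      hasDerivAt_fst := fun x y => by
        have d := ((((hasDerivAt_id x).const_sub 1).const_mul ω).sin).const_mul ω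
        exact ((hv.4 x y).mul d).congr_deriv (by dsimp only [id]; ring)
      hasDerivAt_snd := fun x y => (hv.5 x y).mul_const (ω * Real.sin (ω * (1 - x))) }
  have h2 : HasContinuousPartials (fun p => v p * -(ω * Real.sin (ω * p.2)))
      (fun p => vx p * -(ω * Real.sin (ω * p.2)))
      (fun p => vy p * -(ω * Real.sin (ω * p.2)) + v p * -(ω ^ 2 * Real.cos (ω * p.2))) :=
    { continuous := by fun_prop
      continuous_fst := by fun_prop
      continuous_snd := by fun_prop
      hasDerivAt_fst := fun x y => (hv.4 x y).mul_const (-(ω * Real.sin (ω * y)))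
      hasDerivAt_snd := fun x y => by
        have d : HasDerivAt (fun s => -(ω * Real.sin (ω * s))) (-(ω ^ 2 * Real.cos (ω * y))) y :=
          ((((hasDerivAt_id y).const_mul ω).sin).const_mul ω).neg.congr_deriv
            (by dsimp only [id]; ring)
        exact (hv.5 x y).mul d }
  have e : ∀ p : ℝ × ℝ, vx p * (ω * Real.sin (ω * (1 - p.1))) +
      vy p * -(ω * Real.sin (ω * p.2)) - ω ^ 2 * (v p * edgeMode ω p) =
      (vx p * (ω * Real.sin (ω * (1 - p.1))) + v p * -(ω ^ 2 * Real.cos (ω * (1 - p.1)))) +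
      (vy p * -(ω * Real.sin (ω * p.2)) + v p * -(ω ^ 2 * Real.cos (ω * p.2))) := fun p => by
    unfold edgeMode
    ring
  simp only [e]
  rw [integral_add h1.2.integrableOn_unitTriangle h2.3.integrableOn_unitTriangle,
    h1.setIntegral_fst, h2.setIntegral_snd]
  have flip : ∫ x in (0:ℝ)..1, v (x, 1 - x) * -(ω * Real.sin (ω * (1 - x))) =
      ∫ y in (0:ℝ)..1, v (1 - y, y) * -(ω * Real.sin (ω * y)) := by
    simpa using (integral_comp_sub_left (a := 0) (b := 1)
      (fun y => v (1 - y, y) * -(ω * Real.sin (ω * y))) 1)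
  dsimp only
  rw [flip]
  simp only [sub_sub_cancel, mul_neg, intervalIntegral.integral_neg, sub_zero, mul_one,
    intervalIntegral.integral_mul_const, mul_zero, Real.sin_zero, neg_zero,
    intervalIntegral.integral_zero]
  ring

/-- The Babuška–Aziz inequality on the unit right isosceles triangle, for functions with zero mean
over a leg. The sharp value of `ω` is the first positive root of `sin ω + ω cos ω`. -/
lemma sq_mul_integral_sq_le_of_edge_mean_zero (hv : HasContinuousPartials v vx vy)
    {ω : ℝ} (hω : 0 < ω) (hω8 : ω ^ 2 ≤ 8) (hsin : 0 < Real.sin ω)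
    (hcrit : 0 ≤ Real.sin ω + ω * Real.cos ω)
    (h0 : ∫ y in (0:ℝ)..1, v (0, y) = 0) :
    ω ^ 2 * ∫ p in unitTriangle, v p ^ 2 ≤ ∫ p in unitTriangle, (vx p ^ 2 + vy p ^ 2) := by
  have hG := edgeMode_partials ω
  set G := edgeMode ω with hGdef
  have c := hv.1
  have c1 := hv.2
  have c2 := hv.3
  have cG := hG.1
  have meanG : ω ^ 2 * ∫ p in unitTriangle, G p = ω * Real.sin ω := by
    have h1 : HasContinuousPartials (fun _ => 1) (fun _ => 0) (fun _ => 0) :=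
      ⟨continuous_const, continuous_const, continuous_const,
        fun x y => hasDerivAt_const _ _, fun x y => hasDerivAt_const _ _⟩
    have := h1.green_edgeMode ω
    simp only [zero_mul, zero_add, zero_sub, one_mul, MeasureTheory.integral_neg,
      MeasureTheory.integral_const_mul, intervalIntegral.integral_const, sub_zero, smul_eq_mul,
      mul_one] at this
    linarith
  have hG0 : ∫ p in unitTriangle, G p ≠ 0 := fun h => by
    rw [h, mul_zero] at meanG
    exact (mul_pos hω hsin).ne meanG
  obtain ⟨t, ht⟩ : ∃ t : ℝ, (∫ p in unitTriangle, v p) + t * ∫ p in unitTriangle, G p = 0 :=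
    ⟨-(∫ p in unitTriangle, v p) / ∫ p in unitTriangle, G p, by field_simp; ring⟩
  have hh := hv.add_const_mul hG t
  have hpoin := hh.poincare (by
    rw [integral_add c.integrableOn_unitTriangle (cG.const_mul t).integrableOn_unitTriangle,
      MeasureTheory.integral_const_mul, ht])
  have greenv := hv.green_edgeMode ω
  have greenG := hG.green_edgeMode ω
  rw [← hGdef] at greenv greenG
  rw [h0, mul_zero] at greenv
  have edgeG : ω * ∫ y in (0:ℝ)..1, G (0, y) = ω * Real.cos ω + Real.sin ω := by
    have : ∫ y in (0:ℝ)..1, G (0, y) = Real.cos ω + ∫ y in (0:ℝ)..1, Real.cos (ω * y) := by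
      simp only [hGdef, edgeMode, sub_zero, mul_one]
      rw [intervalIntegral.integral_add (by simp)
        (Continuous.intervalIntegrable (by fun_prop) _ _)]
      simp
    rw [this, mul_add, mul_integral_comp_mul_left]
    simp
  have ii : ∀ {f : ℝ × ℝ → ℝ}, Continuous f → Integrable f (volume.restrict unitTriangle) :=
    fun h => h.integrableOn_unitTriangle
  have expand : (∫ p in unitTriangle, (vx p ^ 2 + vy p ^ 2)) -
      ω ^ 2 * ∫ p in unitTriangle, v p ^ 2 =
      ((∫ p in unitTriangle, ((vx p + t * (ω * Real.sin (ω * (1 - p.1)))) ^ 2 +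
        (vy p + t * -(ω * Real.sin (ω * p.2))) ^ 2)) -
        ω ^ 2 * ∫ p in unitTriangle, (v p + t * G p) ^ 2) -
      2 * t * (∫ p in unitTriangle, (vx p * (ω * Real.sin (ω * (1 - p.1))) +
        vy p * -(ω * Real.sin (ω * p.2)) - ω ^ 2 * (v p * G p))) -
      t ^ 2 * ∫ p in unitTriangle, (ω * Real.sin (ω * (1 - p.1)) * (ω * Real.sin (ω * (1 - p.1))) +
        -(ω * Real.sin (ω * p.2)) * -(ω * Real.sin (ω * p.2)) - ω ^ 2 * (G p * G p)) := by
    simp only [← MeasureTheory.integral_const_mul]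
    rw [← MeasureTheory.integral_sub (ii (by fun_prop)) (ii (by fun_prop)),
      ← MeasureTheory.integral_sub (ii (by fun_prop)) (ii (by fun_prop)),
      ← MeasureTheory.integral_sub (ii (by fun_prop)) (ii (by fun_prop)),
      ← MeasureTheory.integral_sub (ii (by fun_prop)) (ii (by fun_prop))]
    congr 1
    ext p
    ring
  rw [greenv, greenG] at expand
  have hnn : 0 ≤ ∫ p in unitTriangle, (v p + t * G p) ^ 2 := integral_nonneg fun p => sq_nonneg _
  have hsq := mul_le_mul_of_nonneg_right hω8 hnn
  have hlast : 0 ≤ t ^ 2 * (Real.sin ω * (ω * Real.cos ω + Real.sin ω)) :=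
    mul_nonneg (sq_nonneg t) (mul_nonneg hsin.le (by linarith))
  rw [← edgeG] at hlast
  linarith

end HasContinuousPartials

/-- The Babuška–Aziz inequality with the explicit constant `0.49294`. -/
lemma HasContinuousPartials.integral_sq_le {v vx vy : ℝ × ℝ → ℝ}
    (hv : HasContinuousPartials v vx vy) (h0 : ∫ y in (0:ℝ)..1, v (0, y) = 0) :
    ∫ p in unitTriangle, v p ^ 2 ≤
      (0.49294 : ℝ) ^ 2 * ∫ p in unitTriangle, (vx p ^ 2 + vy p ^ 2) := by
  have := hv.sq_mul_integral_sq_le_of_edge_mean_zero (ω := 1 / 0.49294) (by norm_num) (by norm_num)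
    (Real.sin_pos_of_pos_of_lt_pi (by norm_num) (lt_trans (by norm_num) Real.pi_gt_three))
    sin_add_mul_cos_nonneg h0
  calc ∫ p in unitTriangle, v p ^ 2
      = (0.49294 : ℝ) ^ 2 * ((1 / 0.49294) ^ 2 * ∫ p in unitTriangle, v p ^ 2) := by
        rw [← mul_assoc]; norm_num
    _ ≤ _ := mul_le_mul_of_nonneg_left this (by norm_num)

end Triangle

/-- A `C¹` function on a neighbourhood of a closed set agrees near that set with a globally `C¹`
function. -/
lemma exists_contDiff_eventuallyEq_nhdsSet {E F : Type*} [NormedAddCommGroup E] [NormedSpace ℝ E]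
    [FiniteDimensional ℝ E] [NormedAddCommGroup F] [NormedSpace ℝ F] {K U : Set E}
    (hK : IsClosed K) (hU : IsOpen U) (hKU : K ⊆ U) {q : E → F} (hq : ContDiffOn ℝ 1 q U) :
    ∃ g : E → F, ContDiff ℝ 1 g ∧ ∀ x ∈ K, g =ᶠ[nhds x] q := by
  obtain ⟨V, hVo, hKV, hVU⟩ := normal_exists_closure_subset hK hU hKU
  obtain ⟨χ, h1, h0, -⟩ := exists_contMDiffMap_one_nhds_of_subset_interior (n := 1)
    (modelWithCornersSelf ℝ E) hK (hKV.trans hVo.interior_eq.ge)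
  have hχ : ContDiff ℝ 1 χ := χ.contMDiff.contDiff
  refine ⟨fun x => χ x • q x, ?_, fun x hx => ?_⟩
  · rw [contDiff_iff_contDiffAt]
    intro x
    by_cases hx : x ∈ U
    · exact hχ.contDiffAt.smul (hq.contDiffAt (hU.mem_nhds hx))
    · refine (contDiffAt_const (c := (0 : F))).congr_of_eventuallyEq ?_
      filter_upwards [isClosed_closure.isOpen_compl.mem_nhds fun h => hx (hVU h)] with y hy
      rw [h0 y fun h => hy (subset_closure h), zero_smul]
  · filter_upwards [(eventually_nhdsSet_iff_forall.1 h1) x hx] with y hy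
    rw [hy, one_smul]

lemma ContDiff.hasContinuousPartials {v : ℝ × ℝ → ℝ} (hv : ContDiff ℝ 1 v) :
    HasContinuousPartials v (fun p => fderiv ℝ v p (1, 0)) (fun p => fderiv ℝ v p (0, 1)) where
  continuous := hv.continuous
  continuous_fst := (hv.continuous_fderiv one_ne_zero).clm_apply continuous_const
  continuous_snd := (hv.continuous_fderiv one_ne_zero).clm_apply continuous_const
  hasDerivAt_fst x y :=
    ((hv.differentiable one_ne_zero (x, y)).hasFDerivAt).comp_hasDerivAt x
      ((hasDerivAt_id x).prodMk (hasDerivAt_const x y))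
  hasDerivAt_snd x y :=
    ((hv.differentiable one_ne_zero (x, y)).hasFDerivAt).comp_hasDerivAt y
      ((hasDerivAt_const y x).prodMk (hasDerivAt_id y))

lemma hasContinuousPartials_affine (a b c : ℝ) :
    HasContinuousPartials (fun p => a + b * p.1 + c * p.2) (fun _ => b) (fun _ => c) where
  continuous := by fun_prop
  continuous_fst := by fun_prop
  continuous_snd := by fun_prop
  hasDerivAt_fst x y := by
    simpa using (((hasDerivAt_id x).const_mul b).const_add a).add_const (c * y)
  hasDerivAt_snd x y := by
    simpa using ((hasDerivAt_id y).const_mul c).const_add (a + b * x)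

/-- The divergence of a field whose normal component has zero mean over each edge of the triangle
has zero mean. -/
lemma setIntegral_div_eq_zero {v vx vy w wx wy : ℝ × ℝ → ℝ} (hv : HasContinuousPartials v vx vy)
    (hw : HasContinuousPartials w wx wy) (hv0 : ∫ y in (0:ℝ)..1, v (0, y) = 0)
    (hw0 : ∫ x in (0:ℝ)..1, w (x, 0) = 0)
    (hdiag : ∫ t in (0:ℝ)..1, (v (t, 1 - t) + w (t, 1 - t)) = 0) :
    ∫ p in unitTriangle, (vx p + wy p) = 0 := by
  have c1 := hv.1
  have c2 := hw.1
  have flip : ∫ y in (0:ℝ)..1, v (1 - y, y) = ∫ t in (0:ℝ)..1, v (t, 1 - t) := by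
    simpa using integral_comp_sub_left (a := 0) (b := 1) (fun t => v (t, 1 - t)) 1
  rw [intervalIntegral.integral_add (Continuous.intervalIntegrable (by fun_prop) _ _)
    (Continuous.intervalIntegrable (by fun_prop) _ _)] at hdiag
  rw [MeasureTheory.integral_add hv.2.integrableOn_unitTriangle hw.3.integrableOn_unitTriangle,
    hv.setIntegral_fst, hw.setIntegral_snd, hv0, hw0, flip]
  linarith

/-- Fortin (lowest-order Raviart–Thomas) interpolation error estimate on the unit
right isosceles triangle `T`: if the field `R(x) = (a + c·x₁, b + c·x₂)` matches the
edge integrals of the normal component of a `C¹` field `q` on each of the three edges,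
then `‖q − R‖² ≤ 0.49294² · |q|₁²`. -/
theorem stmt_16
    (T : Set (ℝ × ℝ))
    (hT : T = convexHull ℝ {((0 : ℝ), (0 : ℝ)), (1, 0), (0, 1)})
    (q : ℝ × ℝ → ℝ × ℝ)
    (hq : ∃ U : Set (ℝ × ℝ), IsOpen U ∧ T ⊆ U ∧ ContDiffOn ℝ 1 q U)
    (a b c : ℝ)
    (R : ℝ × ℝ → ℝ × ℝ) (hR : ∀ x, R x = (a + c * x.1, b + c * x.2))
    (he1 : ∫ t in (0:ℝ)..1, ((R (t, 0)).2 - (q (t, 0)).2) = 0)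
    (he2 : ∫ t in (0:ℝ)..1, ((R (0, t)).1 - (q (0, t)).1) = 0)
    (he3 : ∫ t in (0:ℝ)..1,
      (((R (t, 1 - t)).1 - (q (t, 1 - t)).1) + ((R (t, 1 - t)).2 - (q (t, 1 - t)).2)) = 0) :
    ∫ x in T, (((q x).1 - (R x).1) ^ 2 + ((q x).2 - (R x).2) ^ 2) ≤
      (0.49294 : ℝ) ^ 2 *
        ∫ x in T,
          ((fderiv ℝ (fun y => (q y).1) x (1, 0)) ^ 2 +
            (fderiv ℝ (fun y => (q y).1) x (0, 1)) ^ 2 +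
            (fderiv ℝ (fun y => (q y).2) x (1, 0)) ^ 2 +
            (fderiv ℝ (fun y => (q y).2) x (0, 1)) ^ 2) := by
  rw [convexHull_eq_unitTriangle] at hT
  subst hT
  obtain ⟨U, hU, hTU, hqU⟩ := hq
  obtain ⟨g, hg, hgq⟩ :=
    exists_contDiff_eventuallyEq_nhdsSet isClosed_unitTriangle hU hTU hqU
  have hm := isClosed_unitTriangle.measurableSet
  have hval : ∀ p ∈ unitTriangle, q p = g p := fun p hp => (hgq p hp).eq_of_nhds.symm
  have hd1 : ∀ p ∈ unitTriangle, fderiv ℝ (fun y => (q y).1) p = fderiv ℝ (fun y => (g y).1) p :=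
    fun p hp => ((hgq p hp).fun_comp Prod.fst).symm.fderiv_eq
  have hd2 : ∀ p ∈ unitTriangle, fderiv ℝ (fun y => (q y).2) p = fderiv ℝ (fun y => (g y).2) p :=
    fun p hp => ((hgq p hp).fun_comp Prod.snd).symm.fderiv_eq
  have hu := hg.fst.hasContinuousPartials
  have hw := hg.snd.hasContinuousPartials
  set ux := fun p => fderiv ℝ (fun y => (g y).1) p (1, 0) with hux
  set uy := fun p => fderiv ℝ (fun y => (g y).1) p (0, 1) with huy
  set wx := fun p => fderiv ℝ (fun y => (g y).2) p (1, 0) with hwx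
  set wy := fun p => fderiv ℝ (fun y => (g y).2) p (0, 1) with hwy
  have he := hu.add_const_mul (hasContinuousPartials_affine a c 0) (-1)
  have hf := hw.add_const_mul (hasContinuousPartials_affine b 0 c) (-1)
  have hleft : ∫ t in (0:ℝ)..1, ((g (0, t)).1 + -1 * (a + c * 0 + 0 * t)) = 0 := by
    refine Eq.trans ?_ (neg_eq_zero.2 he2)
    rw [← intervalIntegral.integral_neg]
    refine intervalIntegral.integral_congr fun t ht => ?_
    rw [uIcc_of_le zero_le_one] at ht
    simp only [hR, hval (0, t) ⟨le_rfl, ht.1, by simpa using ht.2⟩]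
    ring
  have hbot : ∫ t in (0:ℝ)..1, ((g (t, 0)).2 + -1 * (b + 0 * t + c * 0)) = 0 := by
    refine Eq.trans ?_ (neg_eq_zero.2 he1)
    rw [← intervalIntegral.integral_neg]
    refine intervalIntegral.integral_congr fun t ht => ?_
    rw [uIcc_of_le zero_le_one] at ht
    simp only [hR, hval (t, 0) ⟨ht.1, le_rfl, by simpa using ht.2⟩]
    ring
  have hdiag : ∫ t in (0:ℝ)..1, (((g (t, 1 - t)).1 + -1 * (a + c * t + 0 * (1 - t))) +
      ((g (t, 1 - t)).2 + -1 * (b + 0 * t + c * (1 - t)))) = 0 := by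
    refine Eq.trans ?_ (neg_eq_zero.2 he3)
    rw [← intervalIntegral.integral_neg]
    refine intervalIntegral.integral_congr fun t ht => ?_
    rw [uIcc_of_le zero_le_one] at ht
    simp only [hR, hval (t, 1 - t) ⟨ht.1, by simpa using ht.2, by simp⟩]
    ring
  have hdiv := setIntegral_div_eq_zero he hf hleft hbot hdiag
  have h1 := he.integral_sq_le hleft
  have h2 := hf.comp_swap.integral_sq_le hbot
  rw [setIntegral_unitTriangle_swap fun p => ((g p).2 + -1 * (b + 0 * p.1 + c * p.2)) ^ 2,
    setIntegral_unitTriangle_swap fun p => (wy p + -1 * c) ^ 2 + (wx p + -1 * 0) ^ 2] at h2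
  have cg := hg.continuous
  have cux := hu.2
  have cuy := hu.3
  have cwx := hw.2
  have cwy := hw.3
  have ii : ∀ {f : ℝ × ℝ → ℝ}, Continuous f → Integrable f (volume.restrict unitTriangle) :=
    fun h => h.integrableOn_unitTriangle
  have lhs : ∫ x in unitTriangle, (((q x).1 - (R x).1) ^ 2 + ((q x).2 - (R x).2) ^ 2) =
      (∫ p in unitTriangle, ((g p).1 + -1 * (a + c * p.1 + 0 * p.2)) ^ 2) +
        ∫ p in unitTriangle, ((g p).2 + -1 * (b + 0 * p.1 + c * p.2)) ^ 2 := by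
    rw [← MeasureTheory.integral_add (ii (by fun_prop)) (ii (by fun_prop))]
    refine setIntegral_congr_fun hm fun p hp => ?_
    simp only [hR, hval p hp]
    ring
  have rhs : ∫ x in unitTriangle,
          ((fderiv ℝ (fun y => (q y).1) x (1, 0)) ^ 2 +
            (fderiv ℝ (fun y => (q y).1) x (0, 1)) ^ 2 +
            (fderiv ℝ (fun y => (q y).2) x (1, 0)) ^ 2 +
            (fderiv ℝ (fun y => (q y).2) x (0, 1)) ^ 2) =
      (∫ p in unitTriangle, ((ux p + -1 * c) ^ 2 + (uy p + -1 * 0) ^ 2)) +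
        (∫ p in unitTriangle, ((wy p + -1 * c) ^ 2 + (wx p + -1 * 0) ^ 2)) +
        2 * c * (∫ p in unitTriangle, ((ux p + -1 * c) + (wy p + -1 * c))) +
        ∫ p in unitTriangle, 2 * c ^ 2 := by
    rw [← MeasureTheory.integral_const_mul,
      ← MeasureTheory.integral_add (ii (by fun_prop)) (ii (by fun_prop)),
      ← MeasureTheory.integral_add (ii (by fun_prop)) (ii (by fun_prop)),
      ← MeasureTheory.integral_add (ii (by fun_prop)) (ii (by fun_prop))]
    refine setIntegral_congr_fun hm fun p hp => ?_
    simp only [hd1 p hp, hd2 p hp, hux, huy, hwx, hwy]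
    ring
  have hc : 0 ≤ ∫ p in unitTriangle, 2 * c ^ 2 := integral_nonneg fun p => by positivity
  rw [lhs, rhs, hdiv]
  linarith
end

section
/- Let T be the closed triangle in ℝ² with vertices (0,0), (1,0), (0,1), and let 𝒱 be the set of functions v : ℝ² → ℝ that are continuously differentiable on a neighborhood of T, satisfy ∫₀¹ v(t,0) dt = 0 and ∫₀¹ v(0,t) dt = 0, and have ∫_T ((∂v/∂x₁)² + (∂v/∂x₂)²) dx > 0. Then the supremum over v ∈ 𝒱 of (∫_T v² dx)^{1/2} / (∫_T ((∂v/∂x₁)² + (∂v/∂x₂)²) dx)^{1/2} equals the greatest element of the set {μ > 0 : sin(1/(2μ)) + (1/(2μ))·cos(1/(2μ)) = 0}. -/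
open MeasureTheory

namespace TriangleConstant
open Set

/-- `u` is absolutely continuous on `[0, L]` with square-integrable derivative `g`. -/
structure IsPrim (L : ℝ) (u g : ℝ → ℝ) : Prop where
  memLp : MemLp g 2 (volume.restrict (Ioc 0 L))
  eq : ∀ t ∈ Icc 0 L, u t = u 0 + ∫ s in (0 : ℝ)..t, g s

theorem intervalIntegrable_mul {L : ℝ} (hL : 0 ≤ L) {f g : ℝ → ℝ}
    (hf : MemLp f 2 (volume.restrict (Ioc 0 L))) (hg : MemLp g 2 (volume.restrict (Ioc 0 L))) :
    IntervalIntegrable (fun t => f t * g t) volume 0 L := by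
  rw [intervalIntegrable_iff_integrableOn_Ioc_of_le hL]
  exact hf.integrable_mul hg

theorem intervalIntegrable_sq {L : ℝ} (hL : 0 ≤ L) {f : ℝ → ℝ}
    (hf : MemLp f 2 (volume.restrict (Ioc 0 L))) :
    IntervalIntegrable (fun t => f t ^ 2) volume 0 L := by
  rw [intervalIntegrable_iff_integrableOn_Ioc_of_le hL]
  exact hf.integrable_sq

theorem memLp_intervalIntegrable {L : ℝ} (hL : 0 ≤ L) {f : ℝ → ℝ}
    (hf : MemLp f 2 (volume.restrict (Ioc 0 L))) : IntervalIntegrable f volume 0 L := by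
  rw [intervalIntegrable_iff_integrableOn_Ioc_of_le hL]
  exact hf.integrable one_le_two

theorem memLp_of_continuousOn {L : ℝ} {f : ℝ → ℝ} (hf : ContinuousOn f (Icc 0 L)) :
    MemLp f 2 (volume.restrict (Ioc 0 L)) := by
  obtain ⟨C, hC⟩ := isCompact_Icc.exists_bound_of_continuousOn hf
  refine MemLp.of_bound ((hf.mono Ioc_subset_Icc_self).aestronglyMeasurable measurableSet_Ioc) C ?_
  filter_upwards [ae_restrict_mem measurableSet_Ioc] with t ht using hC t (Ioc_subset_Icc_self ht)

namespace IsPrim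
variable {L : ℝ} {u v g h : ℝ → ℝ}

theorem intervalIntegrable (hu : IsPrim L u g) (hL : 0 ≤ L) : IntervalIntegrable g volume 0 L :=
  memLp_intervalIntegrable hL hu.memLp

theorem continuousOn (hu : IsPrim L u g) (hL : 0 ≤ L) : ContinuousOn u (Icc 0 L) := by
  have h1 := (intervalIntegral.continuousOn_primitive_interval' (hu.intervalIntegrable hL)
    (left_mem_uIcc)).const_add (u 0)
  rw [uIcc_of_le hL] at h1
  exact h1.congr fun t ht => hu.eq t ht

theorem memLp' (hu : IsPrim L u g) (hL : 0 ≤ L) : MemLp u 2 (volume.restrict (Ioc 0 L)) :=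
  memLp_of_continuousOn (hu.continuousOn hL)

theorem of_hasDerivAt (hu : ∀ t ∈ Icc 0 L, HasDerivAt u (g t) t)
    (hg : ContinuousOn g (Icc 0 L)) : IsPrim L u g := by
  refine ⟨memLp_of_continuousOn hg, fun t ht => ?_⟩
  have hs : uIcc 0 t ⊆ Icc 0 L := by
    rw [uIcc_of_le ht.1]; exact Icc_subset_Icc_right ht.2
  rw [intervalIntegral.integral_eq_sub_of_hasDerivAt (fun x hx => hu x (hs hx))
    ((hg.mono hs).intervalIntegrable)]
  ring

theorem add (hL : 0 ≤ L) (hu : IsPrim L u g) (hv : IsPrim L v h) :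
    IsPrim L (fun t => u t + v t) (fun t => g t + h t) := by
  refine ⟨hu.memLp.add hv.memLp, fun t ht => ?_⟩
  have hs : uIcc 0 t ⊆ uIcc 0 L := by
    rw [uIcc_of_le ht.1, uIcc_of_le hL]; exact Icc_subset_Icc_right ht.2
  rw [intervalIntegral.integral_add ((hu.intervalIntegrable hL).mono_set hs)
    ((hv.intervalIntegrable hL).mono_set hs), hu.eq t ht, hv.eq t ht]
  ring

theorem const_mul (c : ℝ) (hu : IsPrim L u g) :
    IsPrim L (fun t => c * u t) (fun t => c * g t) := by
  refine ⟨hu.memLp.const_mul c, fun t ht => ?_⟩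
  rw [intervalIntegral.integral_const_mul, hu.eq t ht]
  ring

theorem sub (hL : 0 ≤ L) (hu : IsPrim L u g) (hv : IsPrim L v h) :
    IsPrim L (fun t => u t - v t) (fun t => g t - h t) := by
  simpa [sub_eq_add_neg] using hu.add hL (hv.const_mul (-1))

theorem sub_const (c : ℝ) (hu : IsPrim L u g) : IsPrim L (fun t => u t - c) g :=
  ⟨hu.memLp, fun t ht => by rw [hu.eq t ht]; ring⟩

theorem primitive (hg : MemLp g 2 (volume.restrict (Ioc 0 L))) :
    IsPrim L (fun t => ∫ s in (0 : ℝ)..t, g s) g := ⟨hg, fun t _ => by simp⟩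

theorem mono {M : ℝ} (hML : M ≤ L) (hu : IsPrim L u g) : IsPrim M u g :=
  ⟨hu.memLp.mono_measure (Measure.restrict_mono (Ioc_subset_Ioc_right hML) le_rfl),
    fun t ht => hu.eq t ⟨ht.1, ht.2.trans hML⟩⟩

theorem integral_mul_add_mul (hL : 0 ≤ L) (hu : IsPrim L u g) (hv : IsPrim L v h) :
    ∫ t in (0 : ℝ)..L, (g t * v t + u t * h t) = u L * v L - u 0 * v 0 := by
  have hui := hu.intervalIntegrable hL
  have hvi := hv.intervalIntegrable hL
  have hU := hui.absolutelyContinuousOnInterval_intervalIntegral (c := 0) left_mem_uIcc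
  have hV := hvi.absolutelyContinuousOnInterval_intervalIntegral (c := 0) left_mem_uIcc
  have hcu : AbsolutelyContinuousOnInterval (fun _ : ℝ => u 0) 0 L :=
    (LipschitzWith.const (u 0)).lipschitzOnWith.absolutelyContinuousOnInterval
  have hcv : AbsolutelyContinuousOnInterval (fun _ : ℝ => v 0) 0 L :=
    (LipschitzWith.const (v 0)).lipschitzOnWith.absolutelyContinuousOnInterval
  have key := AbsolutelyContinuousOnInterval.integral_deriv_mul_eq_sub (hcu.add hU) (hcv.add hV)
  have e1 : ∀ t ∈ Icc 0 L, ((fun _ : ℝ => u 0) + fun x => ∫ s in (0 : ℝ)..x, g s) t = u t :=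
    fun t ht => (hu.eq t ht).symm
  have e2 : ∀ t ∈ Icc 0 L, ((fun _ : ℝ => v 0) + fun x => ∫ s in (0 : ℝ)..x, h s) t = v t :=
    fun t ht => (hv.eq t ht).symm
  rw [e1 L ⟨hL, le_rfl⟩, e1 0 ⟨le_rfl, hL⟩, e2 L ⟨hL, le_rfl⟩, e2 0 ⟨le_rfl, hL⟩] at key
  rw [← key]
  apply intervalIntegral.integral_congr_ae
  filter_upwards [hui.ae_hasDerivAt_integral, hvi.ae_hasDerivAt_integral] with t h1 h2 ht
  have ht' := uIoc_subset_uIcc ht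
  have h3 := ((h1 ht' 0 left_mem_uIcc).const_add (u 0)).deriv
  have h4 := ((h2 ht' 0 left_mem_uIcc).const_add (v 0)).deriv
  rw [uIcc_of_le hL] at ht'
  rw [e1 t ht', e2 t ht']
  congr 2
  · exact h3.symm
  · exact h4.symm

theorem mul (hL : 0 ≤ L) (hu : IsPrim L u g) (hv : IsPrim L v h) :
    IsPrim L (fun t => u t * v t) (fun t => g t * v t + u t * h t) := by
  have bdd : ∀ {f w : ℝ → ℝ}, MemLp f 2 (volume.restrict (Ioc 0 L)) → ContinuousOn w (Icc 0 L) →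
      MemLp (fun t => f t * w t) 2 (volume.restrict (Ioc 0 L)) := by
    intro f w hf hw
    obtain ⟨C, hC⟩ := isCompact_Icc.exists_bound_of_continuousOn hw
    refine MemLp.of_le_mul (c := C) hf (hf.1.mul
      ((hw.mono Ioc_subset_Icc_self).aestronglyMeasurable measurableSet_Ioc)) ?_
    filter_upwards [ae_restrict_mem measurableSet_Ioc] with t ht
    rw [norm_mul, mul_comm]
    exact mul_le_mul_of_nonneg_right (hC t (Ioc_subset_Icc_self ht)) (norm_nonneg _)
  refine ⟨(bdd hu.memLp (hv.continuousOn hL)).add ?_, fun t ht => ?_⟩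
  · simpa only [mul_comm] using bdd hv.memLp (hu.continuousOn hL)
  · rw [(hu.mono ht.2).integral_mul_add_mul ht.1 (hv.mono ht.2)]; ring

theorem integral_eq_sub (hL : 0 ≤ L) (hu : IsPrim L u g) :
    ∫ t in (0 : ℝ)..L, g t = u L - u 0 := by
  rw [hu.eq L ⟨hL, le_rfl⟩]; ring

theorem integral_mul_eq (hL : 0 ≤ L) (hu : IsPrim L u g) (hv : IsPrim L v h) :
    ∫ t in (0 : ℝ)..L, g t * v t = u L * v L - u 0 * v 0 - ∫ t in (0 : ℝ)..L, u t * h t := by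
  rw [← hu.integral_mul_add_mul hL hv, intervalIntegral.integral_add
    (intervalIntegrable_mul hL hu.memLp (hv.memLp' hL))
    (intervalIntegrable_mul hL (hu.memLp' hL) hv.memLp)]
  ring

/-- **Wirtinger's inequality** with Dirichlet boundary conditions. -/
theorem dirichlet (hL : 0 ≤ L) {κ : ℝ} (hκ : 0 ≤ κ) (hκL : κ * L < Real.pi)
    (hu : IsPrim L u g) (h0 : u 0 = 0) (h1 : u L = 0) :
    κ ^ 2 * ∫ t in (0 : ℝ)..L, u t ^ 2 ≤ ∫ t in (0 : ℝ)..L, g t ^ 2 := by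
  set τ : ℝ → ℝ := fun t => κ * Real.tan (κ * (t - L / 2)) with hτ
  have hcos : ∀ t ∈ Icc 0 L, Real.cos (κ * (t - L / 2)) ≠ 0 := by
    intro t ht
    refine (Real.cos_pos_of_mem_Ioo ⟨?_, ?_⟩).ne' <;>
    nlinarith [mul_le_mul_of_nonneg_left ht.1 hκ, mul_le_mul_of_nonneg_left ht.2 hκ]
  have hder : ∀ t ∈ Icc 0 L, HasDerivAt τ (κ ^ 2 + τ t ^ 2) t := by
    intro t ht
    have h2 : HasDerivAt (fun t => κ * (t - L / 2)) κ t := by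
      simpa using ((hasDerivAt_id t).sub_const (L / 2)).const_mul κ
    have h3 := ((Real.hasDerivAt_tan (hcos t ht)).comp t h2).const_mul κ
    refine h3.congr_deriv ?_
    simp only [hτ, Real.tan_eq_sin_div_cos]
    have hc := hcos t ht
    have hsc := Real.sin_sq_add_cos_sq (κ * (t - L / 2))
    generalize Real.cos (κ * (t - L / 2)) = c at *
    generalize Real.sin (κ * (t - L / 2)) = s at *
    field_simp
    linear_combination (-κ ^ 2) * hsc
  have hτc : ContinuousOn τ (Icc 0 L) := fun t ht => (hder t ht).continuousAt.continuousWithinAt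
  have hτp : IsPrim L τ (fun t => κ ^ 2 + τ t ^ 2) :=
    of_hasDerivAt hder (continuousOn_const.add (hτc.pow 2))
  have hP := hτp.mul hL (hu.mul hL hu)
  have hI := hP.integral_eq_sub hL
  simp only [h0, h1, mul_zero, sub_zero] at hI
  have hg2 := intervalIntegrable_sq hL hu.memLp
  have hu2 := intervalIntegrable_sq hL (hu.memLp' hL)
  have hnn : 0 ≤ ∫ t in (0 : ℝ)..L, (g t + τ t * u t) ^ 2 :=
    intervalIntegral.integral_nonneg hL fun t _ => sq_nonneg _
  have : ∫ t in (0 : ℝ)..L, (g t + τ t * u t) ^ 2 =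
      (∫ t in (0 : ℝ)..L, g t ^ 2) - (κ ^ 2 * ∫ t in (0 : ℝ)..L, u t ^ 2) +
        ∫ t in (0 : ℝ)..L, ((κ ^ 2 + τ t ^ 2) * (u t * u t) +
          τ t * (g t * u t + u t * g t)) := by
    rw [← intervalIntegral.integral_const_mul, ← intervalIntegral.integral_sub hg2
      (hu2.const_mul _), ← intervalIntegral.integral_add (hg2.sub (hu2.const_mul _))
      (hP.intervalIntegrable hL)]
    congr 1; ext t; ring
  linarith

/-- **Wirtinger's inequality** for functions with vanishing mean. -/
theorem neumann (hL : 0 ≤ L) {κ : ℝ} (hκ : 0 ≤ κ) (hκL : κ * L < Real.pi)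
    (hu : IsPrim L u g) (h0 : ∫ t in (0 : ℝ)..L, u t = 0) :
    κ ^ 2 * ∫ t in (0 : ℝ)..L, u t ^ 2 ≤ ∫ t in (0 : ℝ)..L, g t ^ 2 := by
  have hΦ := primitive (hu.memLp' hL)
  set Φ : ℝ → ℝ := fun t => ∫ s in (0 : ℝ)..t, u s with hΦd
  have hΦ0 : Φ 0 = 0 := by simp [hΦd]
  have hD := hΦ.dirichlet hL hκ hκL hΦ0 h0
  have hI := hΦ.integral_mul_eq hL hu
  have hΦL : Φ L = 0 := h0
  rw [hΦ0, hΦL] at hI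
  have hg2 := intervalIntegrable_sq hL hu.memLp
  have hΦ2 := intervalIntegrable_sq hL (hΦ.memLp' hL)
  have hΦg := intervalIntegrable_mul hL (hΦ.memLp' hL) hu.memLp
  have hnn : 0 ≤ ∫ t in (0 : ℝ)..L, (g t + κ ^ 2 * Φ t) ^ 2 :=
    intervalIntegral.integral_nonneg hL fun t _ => sq_nonneg _
  have : ∫ t in (0 : ℝ)..L, (g t + κ ^ 2 * Φ t) ^ 2 = (∫ t in (0 : ℝ)..L, g t ^ 2) +
      (κ ^ 4 * (∫ t in (0 : ℝ)..L, Φ t ^ 2) + 2 * κ ^ 2 * ∫ t in (0 : ℝ)..L, Φ t * g t) := by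
    rw [← intervalIntegral.integral_const_mul, ← intervalIntegral.integral_const_mul,
      ← intervalIntegral.integral_add (hΦ2.const_mul _) (hΦg.const_mul _),
      ← intervalIntegral.integral_add hg2 ((hΦ2.const_mul _).add (hΦg.const_mul _))]
    congr 1; ext t; ring
  have e : ∫ t in (0 : ℝ)..L, u t * u t = ∫ t in (0 : ℝ)..L, u t ^ 2 := by
    congr 1; ext t; ring
  rw [e] at hI
  have := mul_le_mul_of_nonneg_left hD (sq_nonneg κ)
  nlinarith

theorem reflect (hL : 0 ≤ L) (hu : IsPrim L u g) :
    IsPrim L (fun t => u (L - t)) (fun t => -g (L - t)) := by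
  refine ⟨?_, fun t ht => ?_⟩
  · have hmp := (Measure.measurePreserving_sub_left (volume : Measure ℝ) L).restrict_preimage
      (measurableSet_Ico (a := 0) (b := L))
    simp only [preimage_const_sub_Ico, sub_self, sub_zero] at hmp
    rw [Measure.restrict_congr_set Ico_ae_eq_Ioc] at hmp
    exact (hu.memLp.comp_measurePreserving hmp).neg
  · have h1 := hu.intervalIntegrable hL
    rw [intervalIntegral.integral_neg, intervalIntegral.integral_comp_sub_left (fun s => g s) L]
    have hLt : L - t ∈ Icc 0 L := ⟨by linarith [ht.2], by linarith [ht.1]⟩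
    have := intervalIntegral.integral_add_adjacent_intervals
      (h1.mono_set (c := 0) (d := L - t) (uIcc_subset_uIcc left_mem_uIcc
        (by rwa [uIcc_of_le hL])))
      (h1.mono_set (c := L - t) (d := L) (uIcc_subset_uIcc (by rwa [uIcc_of_le hL])
        right_mem_uIcc))
    rw [hu.eq _ hLt, sub_zero, hu.eq L ⟨hL, le_rfl⟩]
    linarith

theorem integral_half_add_reflect {f : ℝ → ℝ} (hf : IntervalIntegrable f volume 0 1) :
    ∫ t in (0 : ℝ)..1 / 2, (f t + f (1 - t)) = ∫ t in (0 : ℝ)..1, f t := by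
  have hm : (1 / 2 : ℝ) ∈ uIcc (0 : ℝ) 1 := by
    rw [uIcc_of_le zero_le_one]; constructor <;> norm_num
  have h1 := hf.mono_set (uIcc_subset_uIcc left_mem_uIcc hm)
  have h2 := hf.mono_set (uIcc_subset_uIcc hm right_mem_uIcc)
  have h3 := (h2.comp_sub_left 1).symm
  norm_num at h3
  rw [intervalIntegral.integral_add (by simpa using h1) (by simpa using h3),
    intervalIntegral.integral_comp_sub_left (fun s => f s) 1,
    ← intervalIntegral.integral_add_adjacent_intervals h1 h2]
  norm_num

/-- **Wirtinger's inequality** for periodic functions with vanishing mean. -/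
theorem periodic {κ : ℝ} (hκ : 0 ≤ κ) (hκπ : κ < Real.pi) (hu : IsPrim 1 u g)
    (hper : u 0 = u 1) (h0 : ∫ t in (0 : ℝ)..1, u t = 0) :
    (2 * κ) ^ 2 * ∫ t in (0 : ℝ)..1, u t ^ 2 ≤ ∫ t in (0 : ℝ)..1, g t ^ 2 := by
  have h01 : (0 : ℝ) ≤ 1 := zero_le_one
  have hh : (0 : ℝ) ≤ 1 / 2 := by norm_num
  have hh' : (1 / 2 : ℝ) ≤ 1 := by norm_num
  have hE := (hu.add h01 (hu.reflect h01)).mono hh'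
  have hO := (hu.sub h01 (hu.reflect h01)).mono hh'
  have hk : 2 * κ * (1 / 2) < Real.pi := by linarith
  have iE := hE.neumann hh (κ := 2 * κ) (by positivity) hk
    (by rw [integral_half_add_reflect (memLp_intervalIntegrable h01 (hu.memLp' h01)), h0])
  have iO := hO.dirichlet hh (κ := 2 * κ) (by positivity) hk (by simp [hper]) (by norm_num)
  have s1 : (∫ t in (0 : ℝ)..1 / 2, (u t + u (1 - t)) ^ 2) +
      ∫ t in (0 : ℝ)..1 / 2, (u t - u (1 - t)) ^ 2 = 2 * ∫ t in (0 : ℝ)..1, u t ^ 2 := by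
    rw [← integral_half_add_reflect (intervalIntegrable_sq h01 (hu.memLp' h01)),
      ← intervalIntegral.integral_const_mul, ← intervalIntegral.integral_add
      (intervalIntegrable_sq hh (hE.memLp' hh)) (intervalIntegrable_sq hh (hO.memLp' hh))]
    congr 1; ext t; ring
  have s2 : (∫ t in (0 : ℝ)..1 / 2, (g t + -g (1 - t)) ^ 2) +
      ∫ t in (0 : ℝ)..1 / 2, (g t - -g (1 - t)) ^ 2 = 2 * ∫ t in (0 : ℝ)..1, g t ^ 2 := by
    rw [← integral_half_add_reflect (intervalIntegrable_sq h01 hu.memLp),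
      ← intervalIntegral.integral_const_mul, ← intervalIntegral.integral_add
      (intervalIntegrable_sq hh hE.memLp) (intervalIntegrable_sq hh hO.memLp)]
    congr 1; ext t; ring
  nlinarith

/-- A Dirichlet inequality with a rank-one correction, sharp for
`u t = cos (2 * s * (t - 1 / 2)) - cos s`. -/
theorem dirichlet_rankOne {s : ℝ} (hs : 0 < s) (hsπ : s < Real.pi)
    (hroot : Real.sin s + s * Real.cos s = 0) (hu : IsPrim 1 u g) (h0 : u 0 = 0) (h1 : u 1 = 0) :
    (2 * s) ^ 2 * ((∫ t in (0 : ℝ)..1, u t ^ 2) - (∫ t in (0 : ℝ)..1, u t) ^ 2 / 2) ≤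
      ∫ t in (0 : ℝ)..1, g t ^ 2 := by
  have h01 : (0 : ℝ) ≤ 1 := zero_le_one
  set c := Real.cos s with hc
  have hsin : Real.sin s = - (s * c) := by linarith
  have hc0 : c < 0 := by
    have := Real.sin_pos_of_pos_of_lt_pi hs hsπ
    by_contra! h
    nlinarith [mul_nonneg hs.le h]
  set φ : ℝ → ℝ := fun t => Real.cos (2 * s * (t - 1 / 2)) - c with hφ
  set ψ : ℝ → ℝ := fun t => -(2 * s) * Real.sin (2 * s * (t - 1 / 2)) with hψ
  have lin : ∀ t, HasDerivAt (fun t : ℝ => 2 * s * (t - 1 / 2)) (2 * s) t := fun t =>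
    (((hasDerivAt_id t).sub_const (1 / 2)).const_mul (2 * s)).congr_deriv (mul_one _)
  have dφ : ∀ t, HasDerivAt φ (ψ t) t := fun t =>
    ((lin t).cos.sub_const c).congr_deriv (by simp only [hψ]; ring)
  have dψ : ∀ t, HasDerivAt ψ (-(2 * s) ^ 2 * (φ t + c)) t := fun t =>
    ((lin t).sin.const_mul (-(2 * s))).congr_deriv (by simp only [hφ]; ring)
  have pφ : IsPrim 1 φ ψ := of_hasDerivAt (fun t _ => dφ t)
    (fun t _ => (dψ t).continuousAt.continuousWithinAt)
  have pψ : IsPrim 1 ψ (fun t => -(2 * s) ^ 2 * (φ t + c)) := of_hasDerivAt (fun t _ => dψ t)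
    (fun t _ => (((dφ t).continuousAt.add continuousAt_const).const_mul _).continuousWithinAt)
  have e0 : 2 * s * ((0 : ℝ) - 1 / 2) = -s := by ring
  have e1 : 2 * s * ((1 : ℝ) - 1 / 2) = s := by ring
  have φ0 : φ 0 = 0 := by simp only [hφ, e0, Real.cos_neg]; simp [hc]
  have φ1 : φ 1 = 0 := by simp only [hφ, e1]; simp [hc]
  have iφi := memLp_intervalIntegrable h01 (pφ.memLp' h01)
  have iφ : ∫ t in (0 : ℝ)..1, φ t = -2 * c := by
    have h2 := pψ.integral_eq_sub h01
    rw [intervalIntegral.integral_const_mul, intervalIntegral.integral_add iφi (by simp)] at h2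
    simp only [hψ, e0, e1, Real.sin_neg, hsin, intervalIntegral.integral_const, sub_zero,
      one_smul] at h2
    have : (2 * s) ^ 2 ≠ 0 := by positivity
    apply mul_left_cancel₀ this
    linarith
  set r := (∫ t in (0 : ℝ)..1, u t) / (-2 * c) with hr
  have hru : ∫ t in (0 : ℝ)..1, u t = r * (-2 * c) := by
    rw [hr, div_mul_cancel₀]; linarith
  have pG := hu.sub h01 (pφ.const_mul r)
  set G : ℝ → ℝ := fun t => u t - r * φ t with hG
  have iui := memLp_intervalIntegrable h01 (hu.memLp' h01)
  have iG : ∫ t in (0 : ℝ)..1, G t = 0 := by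
    rw [hG, intervalIntegral.integral_sub iui (iφi.const_mul r),
      intervalIntegral.integral_const_mul, iφ, hru]; ring
  have G0 : G 0 = 0 := by simp [hG, h0, φ0]
  have G1 : G 1 = 0 := by simp [hG, h1, φ1]
  have hper := pG.periodic hs.le hsπ (by rw [G0, G1]) iG
  have b1 := pG.integral_mul_eq h01 pψ
  have b2 := pφ.integral_mul_eq h01 pψ
  rw [G0, G1] at b1
  rw [φ0, φ1] at b2
  have iGi := memLp_intervalIntegrable h01 (pG.memLp' h01)
  have iGφ := intervalIntegrable_mul h01 (pG.memLp' h01) (pφ.memLp' h01)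
  have iφφ := intervalIntegrable_sq h01 (pφ.memLp' h01)
  have b1' : ∫ t in (0 : ℝ)..1, G t * (-(2 * s) ^ 2 * (φ t + c)) =
      -(2 * s) ^ 2 * ((∫ t in (0 : ℝ)..1, G t * φ t) + c * ∫ t in (0 : ℝ)..1, G t) := by
    rw [← intervalIntegral.integral_const_mul c, ← intervalIntegral.integral_add iGφ
      (iGi.const_mul c), ← intervalIntegral.integral_const_mul]
    congr 1; ext t; ring
  have b2' : ∫ t in (0 : ℝ)..1, φ t * (-(2 * s) ^ 2 * (φ t + c)) =
      -(2 * s) ^ 2 * ((∫ t in (0 : ℝ)..1, φ t ^ 2) + c * ∫ t in (0 : ℝ)..1, φ t) := by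
    rw [← intervalIntegral.integral_const_mul c, ← intervalIntegral.integral_add iφφ
      (iφi.const_mul c), ← intervalIntegral.integral_const_mul]
    congr 1; ext t; ring
  rw [b1', iG] at b1
  rw [b2', iφ] at b2
  have iGG := intervalIntegrable_sq h01 (pG.memLp' h01)
  have igg := intervalIntegrable_sq h01 pG.memLp
  have igψ := intervalIntegrable_mul h01 pG.memLp (pψ.memLp' h01)
  have iψψ := intervalIntegrable_mul h01 pφ.memLp (pψ.memLp' h01)
  have x1 : ∫ t in (0 : ℝ)..1, u t ^ 2 = (∫ t in (0 : ℝ)..1, G t ^ 2) +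
      ((2 * r) * (∫ t in (0 : ℝ)..1, G t * φ t) + r ^ 2 * ∫ t in (0 : ℝ)..1, φ t ^ 2) := by
    rw [← intervalIntegral.integral_const_mul, ← intervalIntegral.integral_const_mul,
      ← intervalIntegral.integral_add (iGφ.const_mul _) (iφφ.const_mul _),
      ← intervalIntegral.integral_add iGG ((iGφ.const_mul _).add (iφφ.const_mul _))]
    congr 1; ext t; simp only [hG]; ring
  have x2 : ∫ t in (0 : ℝ)..1, g t ^ 2 = (∫ t in (0 : ℝ)..1, (g t - r * ψ t) ^ 2) +
      ((2 * r) * (∫ t in (0 : ℝ)..1, (g t - r * ψ t) * ψ t) +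
        r ^ 2 * ∫ t in (0 : ℝ)..1, ψ t * ψ t) := by
    rw [← intervalIntegral.integral_const_mul, ← intervalIntegral.integral_const_mul,
      ← intervalIntegral.integral_add (igψ.const_mul _) (iψψ.const_mul _),
      ← intervalIntegral.integral_add igg ((igψ.const_mul _).add (iψψ.const_mul _))]
    congr 1; ext t; ring
  rw [x1, x2, b1, b2, hru]
  linarith

end IsPrim

theorem IsPrim.neumann_variance {u g : ℝ → ℝ} {κ : ℝ} (hκ : 0 ≤ κ) (hκπ : κ < Real.pi)
    (hu : IsPrim 1 u g) :
    κ ^ 2 * ((∫ t in (0 : ℝ)..1, u t ^ 2) - (∫ t in (0 : ℝ)..1, u t) ^ 2) ≤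
      ∫ t in (0 : ℝ)..1, g t ^ 2 := by
  have h01 : (0 : ℝ) ≤ 1 := zero_le_one
  set m := ∫ t in (0 : ℝ)..1, u t with hm
  have hi := memLp_intervalIntegrable h01 (hu.memLp' h01)
  have hi2 := intervalIntegrable_sq h01 (hu.memLp' h01)
  have h1 := (hu.sub_const m).neumann h01 hκ (by simpa using hκπ) (by
    rw [intervalIntegral.integral_sub hi (by simp), ← hm]; simp)
  have h2 : ∫ t in (0 : ℝ)..1, (u t - m) ^ 2 = (∫ t in (0 : ℝ)..1, u t ^ 2) -
      ((2 * m) * (∫ t in (0 : ℝ)..1, u t) - ∫ _ in (0 : ℝ)..1, m ^ 2) := by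
    rw [← intervalIntegral.integral_const_mul, ← intervalIntegral.integral_sub
      (hi.const_mul _) (by simp), ← intervalIntegral.integral_sub hi2
      ((hi.const_mul _).sub (by simp))]
    congr 1; ext t; ring
  rw [h2, ← hm] at h1
  simp only [intervalIntegral.integral_const, sub_zero, one_smul] at h1
  linarith

/-- Lebesgue measure on the unit interval. -/
noncomputable abbrev unitMeasure : Measure ℝ := volume.restrict (Ioc 0 1)

instance : IsProbabilityMeasure unitMeasure := ⟨by simp⟩

theorem integrable_of_abs_le {α : Type*} [MeasurableSpace α] {ν : Measure α} [IsFiniteMeasure ν]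
    {f : α → ℝ} (hf : Measurable f) {M : ℝ} (hM : ∀ z, |f z| ≤ M) : Integrable f ν :=
  Integrable.of_bound hf.aestronglyMeasurable M (Filter.Eventually.of_forall hM)

theorem abs_integral_le {α : Type*} [MeasurableSpace α] {ν : Measure α} [IsProbabilityMeasure ν]
    {f : α → ℝ} {M : ℝ} (hM : ∀ z, |f z| ≤ M) : |∫ z, f z ∂ν| ≤ M := by
  simpa using norm_integral_le_of_norm_le_const (μ := ν) (f := f) (Filter.Eventually.of_forall hM)

theorem intervalIntegral_eq_unit (f : ℝ → ℝ) :
    ∫ t in (0 : ℝ)..1, f t = ∫ t, f t ∂unitMeasure :=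
  intervalIntegral.integral_of_le zero_le_one

section Square
variable {f : ℝ × ℝ → ℝ} {M : ℝ}

theorem measurable_integral_fst (hf : Measurable f) :
    Measurable fun y => ∫ x, f (x, y) ∂unitMeasure :=
  (hf.stronglyMeasurable.integral_prod_left' (μ := unitMeasure)).measurable

theorem measurable_integral_snd (hf : Measurable f) :
    Measurable fun x => ∫ y, f (x, y) ∂unitMeasure :=
  (hf.stronglyMeasurable.integral_prod_right' (ν := unitMeasure)).measurable

theorem integral_sub_mean_sq (hf : Measurable f) (hM : ∀ z, |f z| ≤ M) :
    ∫ z, (f z - ∫ x, f (x, z.2) ∂unitMeasure) ^ 2 ∂(unitMeasure.prod unitMeasure) =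
      (∫ z, f z ^ 2 ∂(unitMeasure.prod unitMeasure)) -
        ∫ y, (∫ x, f (x, y) ∂unitMeasure) ^ 2 ∂unitMeasure := by
  set B : ℝ → ℝ := fun y => ∫ x, f (x, y) ∂unitMeasure with hB
  have mB : Measurable B := measurable_integral_fst hf
  have bB : ∀ y, |B y| ≤ M := fun y => abs_integral_le fun x => hM (x, y)
  have mB2 : Measurable fun z : ℝ × ℝ => B z.2 := mB.comp measurable_snd
  have hM0 : 0 ≤ M := (abs_nonneg _).trans (hM 0)
  have i1 : Integrable (fun z => f z ^ 2) (unitMeasure.prod unitMeasure) :=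
    integrable_of_abs_le (hf.pow_const 2) (M := M ^ 2) fun z => by
      rw [abs_pow]; exact pow_le_pow_left₀ (abs_nonneg _) (hM z) 2
  have i2 : Integrable (fun z => f z * B z.2) (unitMeasure.prod unitMeasure) :=
    integrable_of_abs_le (hf.mul mB2) (M := M * M) fun z => by
      rw [abs_mul]; exact mul_le_mul (hM z) (bB _) (abs_nonneg _) hM0
  have i3 : Integrable (fun z : ℝ × ℝ => B z.2 ^ 2) (unitMeasure.prod unitMeasure) :=
    integrable_of_abs_le (mB2.pow_const 2) (M := M ^ 2) fun z => by
      rw [abs_pow]; exact pow_le_pow_left₀ (abs_nonneg _) (bB _) 2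
  have e3 : ∫ z : ℝ × ℝ, B z.2 ^ 2 ∂(unitMeasure.prod unitMeasure) =
      ∫ y, B y ^ 2 ∂unitMeasure := by
    rw [integral_prod _ i3]; simp
  have e2 : ∫ z : ℝ × ℝ, f z * B z.2 ∂(unitMeasure.prod unitMeasure) =
      ∫ y, B y ^ 2 ∂unitMeasure := by
    rw [integral_prod_symm _ i2]
    simp only [integral_mul_const]
    congr 1; ext y; rw [sq]
  have : ∀ z : ℝ × ℝ, (f z - B z.2) ^ 2 = f z ^ 2 - (2 * (f z * B z.2) - B z.2 ^ 2) :=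
    fun z => by ring
  change ∫ z : ℝ × ℝ, (f z - B z.2) ^ 2 ∂(unitMeasure.prod unitMeasure) = _
  simp only [this]
  have i4 : Integrable (fun z => 2 * (f z * B z.2) - B z.2 ^ 2) (unitMeasure.prod unitMeasure) :=
    (i2.const_mul 2).sub i3
  rw [integral_sub i1 i4, integral_sub (i2.const_mul 2) i3,
    integral_const_mul, e2, e3]
  ring

/-- The sharp Poincaré inequality on the unit square for functions that are symmetric about the
antidiagonal and have vanishing mean on the two horizontal sides. -/
theorem square_inequality {w W : ℝ × ℝ → ℝ} {s : ℝ} (hs : 0 < s) (hsπ : Real.sqrt 2 * s < Real.pi)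
    (hroot : Real.sin s + s * Real.cos s = 0) (hw : Measurable w) (hW : Measurable W)
    (bw : ∀ z, |w z| ≤ M) (bW : ∀ z, |W z| ≤ M)
    (hprim : ∀ x ∈ Icc (0 : ℝ) 1, ∀ y ∈ Icc (0 : ℝ) 1,
      w (x, y) = w (x, 0) + ∫ t in (0 : ℝ)..y, W (x, t))
    (hsymm : ∀ x ∈ Icc (0 : ℝ) 1, ∀ y ∈ Icc (0 : ℝ) 1, w (x, y) = w (1 - y, 1 - x))
    (h0 : ∫ t in (0 : ℝ)..1, w (t, 0) = 0) (h1 : ∫ t in (0 : ℝ)..1, w (t, 1) = 0) :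
    2 * s ^ 2 * ∫ z, w z ^ 2 ∂(unitMeasure.prod unitMeasure) ≤
      ∫ z, W z ^ 2 ∂(unitMeasure.prod unitMeasure) := by
  have h01 : (0 : ℝ) ≤ 1 := zero_le_one
  have hM0 : 0 ≤ M := (abs_nonneg _).trans (bw 0)
  set B : ℝ → ℝ := fun y => ∫ x, w (x, y) ∂unitMeasure with hB
  set β : ℝ → ℝ := fun y => ∫ x, W (x, y) ∂unitMeasure with hβ
  set A : ℝ → ℝ := fun x => ∫ y, w (x, y) ∂unitMeasure with hA
  have mB : Measurable B := measurable_integral_fst hw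
  have mβ : Measurable β := measurable_integral_fst hW
  have mA : Measurable A := measurable_integral_snd hw
  have bB : ∀ y, |B y| ≤ M := fun y => abs_integral_le fun x => bw (x, y)
  have bβ : ∀ y, |β y| ≤ M := fun y => abs_integral_le fun x => bW (x, y)
  have bA : ∀ y, |A y| ≤ M := fun x => abs_integral_le fun y => bw (x, y)
  have memL : ∀ {g : ℝ → ℝ}, Measurable g → (∀ t, |g t| ≤ M) → MemLp g 2 unitMeasure :=
    fun hg hb => MemLp.of_bound hg.aestronglyMeasurable M (Filter.Eventually.of_forall hb)
  have pB : IsPrim 1 B β := by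
    refine ⟨memL mβ bβ, fun y hy => ?_⟩
    have e : B y = ∫ x, (w (x, 0) + ∫ t in (0 : ℝ)..y, W (x, t)) ∂unitMeasure := by
      refine setIntegral_congr_fun measurableSet_Ioc fun x hx => ?_
      exact hprim x (Ioc_subset_Icc_self hx) y hy
    have iW : Integrable W (unitMeasure.prod (volume.restrict (Ioc 0 y))) :=
      integrable_of_abs_le hW bW
    simp only [intervalIntegral.integral_of_le hy.1] at e ⊢
    have iw0 : Integrable (fun x => w (x, 0)) unitMeasure :=
      integrable_of_abs_le (hw.comp (by fun_prop)) fun x => bw (x, 0)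
    rw [e, integral_add iw0 iW.integral_prod_left,
      integral_integral_swap (f := fun x t => W (x, t)) iW]
  have hsπ' : s < Real.pi := by
    have : 1 ≤ Real.sqrt 2 := by rw [Real.one_le_sqrt]; norm_num
    nlinarith
  have hB0 : B 0 = 0 := by rw [intervalIntegral_eq_unit] at h0; exact h0
  have hB1 : B 1 = 0 := by rw [intervalIntegral_eq_unit] at h1; exact h1
  have k1 := pB.dirichlet_rankOne hs hsπ' hroot hB0 hB1
  have iw := integrable_of_abs_le (ν := unitMeasure.prod unitMeasure) hw bw
  have k2 : ∀ x ∈ Ioc (0 : ℝ) 1, (Real.sqrt 2 * s) ^ 2 *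
      ((∫ y, (w (x, y) - B y) ^ 2 ∂unitMeasure) - (A x - ∫ y, B y ∂unitMeasure) ^ 2) ≤
      ∫ y, (W (x, y) - β y) ^ 2 ∂unitMeasure := by
    intro x hx
    have px : IsPrim 1 (fun y => w (x, y)) (fun y => W (x, y)) :=
      ⟨memL (hW.comp (by fun_prop)) fun y => bW (x, y), fun y hy =>
        hprim x (Ioc_subset_Icc_self hx) y hy⟩
    have := (px.sub h01 pB).neumann_variance (κ := Real.sqrt 2 * s) (by positivity) hsπ
    simp only [intervalIntegral_eq_unit] at this
    have iwx : Integrable (fun y => w (x, y)) unitMeasure :=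
      integrable_of_abs_le (hw.comp (by fun_prop)) fun y => bw (x, y)
    rwa [integral_sub iwx (integrable_of_abs_le mB bB)] at this
  have sq_le : ∀ {a : ℝ} {K : ℝ}, |a| ≤ K → |a ^ 2| ≤ K ^ 2 := fun h => by
    rw [abs_pow]; exact pow_le_pow_left₀ (abs_nonneg _) h 2
  have sub_le : ∀ {a b : ℝ}, |a| ≤ M → |b| ≤ M → |a - b| ≤ M + M := fun ha hb =>
    (abs_sub _ _).trans (add_le_add ha hb)
  have i1 : Integrable (fun z : ℝ × ℝ => (w z - B z.2) ^ 2) (unitMeasure.prod unitMeasure) :=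
    integrable_of_abs_le ((hw.sub (mB.comp measurable_snd)).pow_const 2)
      fun z => sq_le (sub_le (bw z) (bB z.2))
  have i2 : Integrable (fun z : ℝ × ℝ => (W z - β z.2) ^ 2) (unitMeasure.prod unitMeasure) :=
    integrable_of_abs_le ((hW.sub (mβ.comp measurable_snd)).pow_const 2)
      fun z => sq_le (sub_le (bW z) (bβ z.2))
  have i3 : Integrable (fun x => (A x - ∫ y, B y ∂unitMeasure) ^ 2) unitMeasure :=
    integrable_of_abs_le ((mA.sub_const _).pow_const 2)
      fun x => sq_le (sub_le (bA x) (abs_integral_le bB))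
  have k3 := setIntegral_mono_on
    ((i1.integral_prod_left.sub i3).const_mul ((Real.sqrt 2 * s) ^ 2)) i2.integral_prod_left
    measurableSet_Ioc k2
  simp only [Pi.sub_apply] at k3
  rw [integral_const_mul, integral_sub i1.integral_prod_left i3, ← integral_prod _ i1,
    ← integral_prod _ i2, integral_sub_mean_sq hw bw, integral_sub_mean_sq hW bW] at k3
  have eAB : ∀ x ∈ Icc (0 : ℝ) 1, A x = B (1 - x) := by
    intro x hx
    simp only [hA, hB, ← intervalIntegral_eq_unit]
    have : ∫ y in (0 : ℝ)..1, w (x, y) = ∫ y in (0 : ℝ)..1, (fun y => w (y, 1 - x)) (1 - y) := by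
      refine intervalIntegral.integral_congr fun y hy => ?_
      rw [uIcc_of_le h01] at hy
      exact hsymm x hx y hy
    rw [this, intervalIntegral.integral_comp_sub_left (fun y => w (y, 1 - x)) 1]
    norm_num
  have eA : ∀ F : ℝ → ℝ, ∫ x, F (A x) ∂unitMeasure = ∫ x, F (B x) ∂unitMeasure := by
    intro F
    have h2 : ∫ x in (0 : ℝ)..1, F (A x) = ∫ x in (0 : ℝ)..1, (fun t => F (B t)) (1 - x) := by
      refine intervalIntegral.integral_congr fun x hx => ?_
      rw [uIcc_of_le h01] at hx
      simp only [eAB x hx]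
    rw [← intervalIntegral_eq_unit, h2,
      intervalIntegral.integral_comp_sub_left (fun t => F (B t)) 1, ← intervalIntegral_eq_unit]
    norm_num
  rw [eA fun a => (a - ∫ y, B y ∂unitMeasure) ^ 2] at k3
  simp only [intervalIntegral_eq_unit] at k1
  set c := ∫ y, B y ∂unitMeasure with hc
  have iB := integrable_of_abs_le (ν := unitMeasure) mB bB
  have iB2 := integrable_of_abs_le (ν := unitMeasure) (mB.pow_const 2) fun y => sq_le (bB y)
  have e4 : ∫ y, (B y - c) ^ 2 ∂unitMeasure = (∫ y, B y ^ 2 ∂unitMeasure) - c ^ 2 := by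
    have : ∀ y, (B y - c) ^ 2 = B y ^ 2 - (2 * c * B y - c ^ 2) := fun y => by ring
    simp only [this]
    have i4 : Integrable (fun y => 2 * c * B y - c ^ 2) unitMeasure :=
      (iB.const_mul _).sub (integrable_const _)
    rw [integral_sub iB2 i4, integral_sub
      (iB.const_mul _) (integrable_const _), integral_const_mul, ← hc]
    simp
    ring
  rw [e4, mul_pow, Real.sq_sqrt zero_le_two] at k3
  change 2 * s ^ 2 * ((∫ z, w z ^ 2 ∂(unitMeasure.prod unitMeasure)) -
    (∫ y, B y ^ 2 ∂unitMeasure) - _) ≤ (∫ z, W z ^ 2 ∂(unitMeasure.prod unitMeasure)) -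
    ∫ y, β y ^ 2 ∂unitMeasure at k3
  linarith

end Square

/-- The unit right isosceles triangle. -/
def triangle : Set (ℝ × ℝ) := {z | 0 ≤ z.1 ∧ 0 ≤ z.2 ∧ z.1 + z.2 ≤ 1}

theorem convexHull_eq_triangle :
    convexHull ℝ {((0 : ℝ), (0 : ℝ)), (1, 0), (0, 1)} = triangle := by
  apply Subset.antisymm
  · refine convexHull_min ?_ ?_
    · rintro z (rfl | rfl | rfl) <;> norm_num [triangle]
    · rintro ⟨a, b⟩ ⟨h1, h2, h3⟩ ⟨c, d⟩ ⟨h4, h5, h6⟩ p q hp hq hpq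
      simp only at h1 h2 h3 h4 h5 h6
      refine ⟨?_, ?_, ?_⟩ <;> simp only [Prod.smul_mk, smul_eq_mul, Prod.mk_add_mk]
      · positivity
      · positivity
      · nlinarith
  · rintro ⟨a, b⟩ ⟨h1, h2, h3⟩
    simp only at h1 h2 h3
    have hc := convex_convexHull ℝ {((0 : ℝ), (0 : ℝ)), (1, 0), (0, 1)}
    have hs := subset_convexHull ℝ {((0 : ℝ), (0 : ℝ)), (1, 0), (0, 1)}
    have h := hc.sum_mem (t := Finset.univ) (w := ![1 - a - b, a, b])
      (z := ![((0 : ℝ), (0 : ℝ)), (1, 0), (0, 1)])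
      (by
        intro i _
        fin_cases i
        · change 0 ≤ 1 - a - b
          linarith
        · exact h1
        · exact h2)
      (by simp [Fin.sum_univ_three]; ring)
      (by intro i _; apply hs; fin_cases i <;> simp)
    simpa [Fin.sum_univ_three] using h

theorem isCompact_triangle : IsCompact triangle := by
  rw [← convexHull_eq_triangle]
  exact (Set.toFinite _).isCompact_convexHull ℝ

theorem measurableSet_triangle : MeasurableSet triangle := isCompact_triangle.measurableSet

/-- The reflection of the plane in the antidiagonal of the unit square. -/
def antiReflect (z : ℝ × ℝ) : ℝ × ℝ := (1 - z.2, 1 - z.1)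

theorem involutive_antiReflect : Function.Involutive antiReflect := fun z => by
  simp [antiReflect]

theorem measurePreserving_antiReflect : MeasurePreserving antiReflect := by
  have h := Measure.measurePreserving_sub_left (volume : Measure ℝ) 1
  exact (h.prod h).comp Measure.measurePreserving_swap

theorem measurableEmbedding_antiReflect : MeasurableEmbedding antiReflect :=
  (MeasurableEquiv.ofInvolutive antiReflect involutive_antiReflect
    measurePreserving_antiReflect.measurable).measurableEmbedding

theorem ae_add_ne (c : ℝ) : ∀ᵐ z : ℝ × ℝ, z.1 + z.2 ≠ c := by
  have hm : MeasurableSet {z : ℝ × ℝ | z.1 + z.2 = c} :=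
    measurableSet_eq_fun (by fun_prop) (by fun_prop)
  have : volume {z : ℝ × ℝ | z.1 + z.2 = c} = 0 := by
    rw [Measure.volume_eq_prod, Measure.measure_prod_null hm]
    refine Filter.Eventually.of_forall fun x => ?_
    have : Prod.mk x ⁻¹' {z : ℝ × ℝ | z.1 + z.2 = c} = {c - x} := by
      ext y; simp [eq_sub_iff_add_eq, add_comm]
    simp [this]
  filter_upwards [compl_mem_ae_iff.2 this] with z hz using hz

theorem ae_fst_ne (c : ℝ) : ∀ᵐ z : ℝ × ℝ, z.1 ≠ c :=
  Measure.quasiMeasurePreserving_fst.ae (compl_mem_ae_iff.2 (Real.volume_singleton (a := c)))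

theorem ae_snd_ne (c : ℝ) : ∀ᵐ z : ℝ × ℝ, z.2 ≠ c :=
  Measure.quasiMeasurePreserving_snd.ae (compl_mem_ae_iff.2 (Real.volume_singleton (a := c)))

theorem unitMeasure_prod : unitMeasure.prod unitMeasure =
    (volume : Measure (ℝ × ℝ)).restrict (Ioc 0 1 ×ˢ Ioc 0 1) := by
  rw [Measure.prod_restrict, Measure.volume_eq_prod]

theorem square_inter_triangle_ae_eq :
    ((Ioc (0 : ℝ) 1 ×ˢ Ioc (0 : ℝ) 1) ∩ triangle : Set (ℝ × ℝ)) =ᵐ[volume] triangle := by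
  rw [Filter.eventuallyEq_set]
  filter_upwards [ae_fst_ne 0, ae_snd_ne 0] with z h1 h2
  refine ⟨fun h => h.2, fun h => ⟨⟨⟨lt_of_le_of_ne h.1 h1.symm, ?_⟩,
    ⟨lt_of_le_of_ne h.2.1 h2.symm, ?_⟩⟩, h⟩⟩ <;>
  linarith [h.1, h.2.1, h.2.2]

theorem square_diff_triangle_ae_eq :
    ((Ioc (0 : ℝ) 1 ×ˢ Ioc (0 : ℝ) 1) \ triangle : Set (ℝ × ℝ)) =ᵐ[volume]
      antiReflect ⁻¹' triangle := by
  rw [Filter.eventuallyEq_set]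
  filter_upwards [ae_fst_ne 0, ae_snd_ne 0, ae_add_ne 1] with z h1 h2 h3
  simp only [triangle, antiReflect, mem_sdiff, mem_prod, mem_Ioc, mem_ofPred_eq, mem_preimage,
    not_and, not_le]
  constructor
  · rintro ⟨⟨⟨a, b⟩, c, d⟩, e⟩
    have := e a.le c.le
    refine ⟨?_, ?_, ?_⟩ <;> linarith
  · rintro ⟨a, b, c⟩
    have : 1 < z.1 + z.2 := lt_of_le_of_ne (by linarith) (Ne.symm h3)
    refine ⟨⟨⟨?_, ?_⟩, ?_, ?_⟩, fun _ _ => this⟩ <;> linarith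

theorem integral_square_eq {F : ℝ × ℝ → ℝ} (hF : Integrable F (unitMeasure.prod unitMeasure)) :
    ∫ z, F z ∂(unitMeasure.prod unitMeasure) =
      ∫ z in triangle, (F z + F (antiReflect z)) := by
  rw [unitMeasure_prod] at hF ⊢
  have hF' : IntegrableOn F (Ioc (0 : ℝ) 1 ×ˢ Ioc (0 : ℝ) 1) := hF
  have e := integral_inter_add_sdiff measurableSet_triangle hF'
  have i1 : IntegrableOn F triangle :=
    (hF'.mono_set inter_subset_left).congr_set_ae square_inter_triangle_ae_eq.symm
  have i2 : IntegrableOn F (antiReflect ⁻¹' triangle) :=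
    (hF'.mono_set sdiff_subset).congr_set_ae square_diff_triangle_ae_eq.symm
  have hFR : F = (F ∘ antiReflect) ∘ antiReflect := by
    ext z; simp [involutive_antiReflect z]
  rw [hFR, measurePreserving_antiReflect.integrableOn_comp_preimage
    measurableEmbedding_antiReflect] at i2
  have e2 := measurePreserving_antiReflect.setIntegral_preimage_emb
    measurableEmbedding_antiReflect (F ∘ antiReflect) triangle
  simp only [Function.comp_apply, involutive_antiReflect _] at e2
  rw [← e, setIntegral_congr_set square_inter_triangle_ae_eq,
    setIntegral_congr_set square_diff_triangle_ae_eq, e2]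
  exact (integral_add i1 i2).symm

/-- The projection of the real line onto the unit interval. -/
noncomputable def clamp (t : ℝ) : ℝ := max 0 (min 1 t)

theorem clamp_of_mem {t : ℝ} (ht : t ∈ Icc (0 : ℝ) 1) : clamp t = t := by
  simp [clamp, ht.1, ht.2]

theorem continuous_clamp : Continuous clamp := by unfold clamp; fun_prop

/-- The map of the plane onto the triangle which folds the unit square along its antidiagonal. -/
noncomputable def fold (z : ℝ × ℝ) : ℝ × ℝ :=
  (min (clamp z.1) (1 - clamp z.2), min (clamp z.2) (1 - clamp z.1))

theorem continuous_fold : Continuous fold := by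
  have := continuous_clamp
  unfold fold; fun_prop

theorem fold_mem (z : ℝ × ℝ) : fold z ∈ triangle := by
  have h : ∀ t, 0 ≤ clamp t ∧ clamp t ≤ 1 := fun t =>
    ⟨le_max_left _ _, max_le zero_le_one (min_le_left _ _)⟩
  obtain ⟨a, b⟩ := h z.1
  obtain ⟨c, d⟩ := h z.2
  refine ⟨le_min a (by linarith), le_min c (by linarith), ?_⟩
  have h1 := min_le_left (clamp z.1) (1 - clamp z.2)
  have h2 := min_le_right (clamp z.1) (1 - clamp z.2)
  have h3 := min_le_left (clamp z.2) (1 - clamp z.1)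
  have h4 := min_le_right (clamp z.2) (1 - clamp z.1)
  simp only [fold]
  linarith

theorem fold_of_add_le {x y : ℝ} (hx : x ∈ Icc (0 : ℝ) 1) (hy : y ∈ Icc (0 : ℝ) 1)
    (h : x + y ≤ 1) : fold (x, y) = (x, y) := by
  simp only [fold, clamp_of_mem hx, clamp_of_mem hy]
  rw [min_eq_left (by linarith), min_eq_left (by linarith)]

theorem fold_of_le_add {x y : ℝ} (hx : x ∈ Icc (0 : ℝ) 1) (hy : y ∈ Icc (0 : ℝ) 1)
    (h : 1 ≤ x + y) : fold (x, y) = (1 - y, 1 - x) := by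
  simp only [fold, clamp_of_mem hx, clamp_of_mem hy]
  rw [min_eq_right (by linarith), min_eq_right (by linarith)]

theorem fold_of_mem {z : ℝ × ℝ} (hz : z ∈ triangle) : fold z = z :=
  fold_of_add_le ⟨hz.1, by linarith [hz.2.1, hz.2.2]⟩ ⟨hz.2.1, by linarith [hz.1, hz.2.2]⟩ hz.2.2

theorem fold_antiReflect_of_mem {z : ℝ × ℝ} (hz : z ∈ triangle) : fold (antiReflect z) = z := by
  obtain ⟨a, b, c⟩ := hz
  rw [antiReflect, fold_of_le_add ⟨by linarith, by linarith⟩ ⟨by linarith, by linarith⟩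
    (by linarith)]
  simp

theorem fold_symm {x y : ℝ} (hx : x ∈ Icc (0 : ℝ) 1) (hy : y ∈ Icc (0 : ℝ) 1) :
    fold (x, y) = fold (1 - y, 1 - x) := by
  have hx' : 1 - x ∈ Icc (0 : ℝ) 1 := ⟨by linarith [hx.2], by linarith [hx.1]⟩
  have hy' : 1 - y ∈ Icc (0 : ℝ) 1 := ⟨by linarith [hy.2], by linarith [hy.1]⟩
  simp only [fold, clamp_of_mem hx, clamp_of_mem hy, clamp_of_mem hx', clamp_of_mem hy',
    sub_sub_cancel, min_comm]

/-- The sharp Poincaré inequality on the triangle. -/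
theorem triangle_inequality {v : ℝ × ℝ → ℝ} {U : Set (ℝ × ℝ)} {s : ℝ} (hs : 0 < s)
    (hsπ : Real.sqrt 2 * s < Real.pi) (hroot : Real.sin s + s * Real.cos s = 0)
    (hU : IsOpen U) (hTU : triangle ⊆ U) (hv : ContDiffOn ℝ 1 v U)
    (h0 : ∫ t in (0 : ℝ)..1, v (t, 0) = 0) (h1 : ∫ t in (0 : ℝ)..1, v (0, t) = 0) :
    (2 * s) ^ 2 * ∫ z in triangle, v z ^ 2 ≤
      ∫ z in triangle, (fderiv ℝ v z (1, 0) ^ 2 + fderiv ℝ v z (0, 1) ^ 2) := by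
  have h01 : (0 : ℝ) ≤ 1 := zero_le_one
  have cv : ContinuousOn v triangle := hv.continuousOn.mono hTU
  have cd : ContinuousOn (fderiv ℝ v) triangle :=
    (hv.continuousOn_fderiv_of_isOpen hU le_rfl).mono hTU
  have c1 : ContinuousOn (fun z => fderiv ℝ v z (1, 0)) triangle := cd.clm_apply continuousOn_const
  have c2 : ContinuousOn (fun z => fderiv ℝ v z (0, 1)) triangle := cd.clm_apply continuousOn_const
  obtain ⟨C0, hC0⟩ := isCompact_triangle.exists_bound_of_continuousOn cv
  obtain ⟨C1, hC1⟩ := isCompact_triangle.exists_bound_of_continuousOn c1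
  obtain ⟨C2, hC2⟩ := isCompact_triangle.exists_bound_of_continuousOn c2
  set M := max C0 (max C1 C2)
  set w : ℝ × ℝ → ℝ := fun z => v (fold z) with hw
  set W : ℝ × ℝ → ℝ := fun z => if z.1 + z.2 < 1 then fderiv ℝ v (fold z) (0, 1)
    else -fderiv ℝ v (fold z) (1, 0) with hW
  have cw : Continuous w := cv.comp_continuous continuous_fold fold_mem
  have mW : Measurable W := by
    refine Measurable.ite (measurableSet_lt (by fun_prop) (by fun_prop)) ?_ ?_
    · exact (c2.comp_continuous continuous_fold fold_mem).measurable
    · exact (c1.comp_continuous continuous_fold fold_mem).measurable.neg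
  have bw : ∀ z, |w z| ≤ M := fun z => (hC0 _ (fold_mem z)).trans (le_max_left _ _)
  have bW : ∀ z, |W z| ≤ M := fun z => by
    simp only [hW]
    split_ifs
    · exact (hC2 _ (fold_mem z)).trans ((le_max_right _ _).trans (le_max_right _ _))
    · rw [abs_neg]
      exact (hC1 _ (fold_mem z)).trans ((le_max_left _ _).trans (le_max_right _ _))
  have hd : ∀ z ∈ triangle, HasFDerivAt v (fderiv ℝ v z) z := fun z hz =>
    ((hv.differentiableOn one_ne_zero).differentiableAt (hU.mem_nhds (hTU hz))).hasFDerivAt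
  have hprim : ∀ x ∈ Icc (0 : ℝ) 1, ∀ y ∈ Icc (0 : ℝ) 1,
      w (x, y) = w (x, 0) + ∫ t in (0 : ℝ)..y, W (x, t) := by
    intro x hx y hy
    have := integral_eq_of_hasDerivAt_off_countable_of_le (fun t => w (x, t))
      (fun t => W (x, t)) hy.1 (countable_singleton (1 - x))
      (cw.comp (by fun_prop)).continuousOn ?_ ?_
    · rw [this]; ring
    · rintro t ⟨⟨ht0, hty⟩, hne⟩
      have ht1 : t < 1 := hty.trans_le hy.2
      rcases lt_or_gt_of_ne (show t ≠ 1 - x from hne) with h | h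
      · have e : (fun t => w (x, t)) =ᶠ[nhds t] fun t => v (x, t) := by
          filter_upwards [Ioo_mem_nhds ht0 h] with r hr
          simp only [hw]
          rw [fold_of_add_le hx ⟨hr.1.le, by linarith [hr.2, hx.1]⟩ (by linarith [hr.2])]
        refine HasDerivAt.congr_of_eventuallyEq ?_ e
        have hm : fold (x, t) = (x, t) := fold_of_add_le hx ⟨ht0.le, ht1.le⟩ (by linarith)
        simp only [hW, hm]
        rw [if_pos (by linarith)]
        exact (hd (x, t) (hm ▸ fold_mem (x, t))).comp_hasDerivAt t
          ((hasDerivAt_const t x).prodMk (hasDerivAt_id t))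
      · have e : (fun t => w (x, t)) =ᶠ[nhds t] fun t => v (1 - t, 1 - x) := by
          filter_upwards [Ioo_mem_nhds h ht1] with r hr
          simp only [hw]
          rw [fold_of_le_add hx ⟨by linarith [hr.1, hx.2], hr.2.le⟩ (by linarith [hr.1])]
        refine HasDerivAt.congr_of_eventuallyEq ?_ e
        have hm : fold (x, t) = (1 - t, 1 - x) :=
          fold_of_le_add hx ⟨ht0.le, ht1.le⟩ (by linarith)
        simp only [hW, hm]
        rw [if_neg (by linarith)]
        have := (hd (1 - t, 1 - x) (hm ▸ fold_mem (x, t))).comp_hasDerivAt t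
          (((hasDerivAt_id t).const_sub 1).prodMk (hasDerivAt_const t (1 - x)))
        refine this.congr_deriv ?_
        rw [show ((-1 : ℝ), (0 : ℝ)) = -(1, 0) by simp, map_neg]
    · rw [intervalIntegrable_iff_integrableOn_Ioc_of_le hy.1]
      exact integrable_of_abs_le (mW.comp (by fun_prop)) fun t => bW (x, t)
  have hw0 : ∫ t in (0 : ℝ)..1, w (t, 0) = 0 := by
    refine (intervalIntegral.integral_congr fun t ht => ?_).trans h0
    rw [uIcc_of_le h01] at ht
    simp only [hw]
    rw [fold_of_add_le ht ⟨le_rfl, h01⟩ (by linarith [ht.2])]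
  have hw1 : ∫ t in (0 : ℝ)..1, w (t, 1) = 0 := by
    have : ∫ t in (0 : ℝ)..1, w (t, 1) = ∫ t in (0 : ℝ)..1, (fun t => v (0, t)) (1 - t) := by
      refine intervalIntegral.integral_congr fun t ht => ?_
      rw [uIcc_of_le h01] at ht
      simp only [hw]
      rw [fold_of_le_add ht ⟨h01, le_rfl⟩ (by linarith [ht.1]), sub_self]
    rw [this, intervalIntegral.integral_comp_sub_left (fun t => v (0, t)) 1]
    simpa using h1
  have key := square_inequality hs hsπ hroot cw.measurable mW bw bW hprim
    (fun x hx y hy => congrArg v (fold_symm hx hy)) hw0 hw1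
  have sq_le : ∀ {a : ℝ}, |a| ≤ M → |a ^ 2| ≤ M ^ 2 := fun h => by
    rw [abs_pow]; exact pow_le_pow_left₀ (abs_nonneg _) h 2
  rw [integral_square_eq (integrable_of_abs_le (cw.measurable.pow_const 2) fun z => sq_le (bw z)),
    integral_square_eq (integrable_of_abs_le (mW.pow_const 2) fun z => sq_le (bW z))] at key
  have e1 : ∫ z in triangle, (w z ^ 2 + w (antiReflect z) ^ 2) =
      2 * ∫ z in triangle, v z ^ 2 := by
    rw [← integral_const_mul]
    refine setIntegral_congr_fun measurableSet_triangle fun z hz => ?_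
    simp only [hw, fold_of_mem hz, fold_antiReflect_of_mem hz]
    ring
  have e2 : ∫ z in triangle, (W z ^ 2 + W (antiReflect z) ^ 2) =
      ∫ z in triangle, (fderiv ℝ v z (1, 0) ^ 2 + fderiv ℝ v z (0, 1) ^ 2) := by
    refine setIntegral_congr_ae measurableSet_triangle ?_
    filter_upwards [ae_add_ne 1] with z hne hz
    have hlt : z.1 + z.2 < 1 := lt_of_le_of_ne hz.2.2 hne
    simp only [hW, fold_of_mem hz, fold_antiReflect_of_mem hz]
    rw [if_pos hlt, if_neg (by simp only [antiReflect]; linarith)]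
    ring
  rw [e1, e2] at key
  linarith


theorem exists_least_root : ∃ s : ℝ, 0 < s ∧ Real.sqrt 2 * s < Real.pi ∧
    Real.sin s + s * Real.cos s = 0 ∧
    ∀ r : ℝ, 0 < r → Real.sin r + r * Real.cos r = 0 → s ≤ r := by
  have hπ := Real.pi_pos
  have hπ3 := Real.pi_gt_three
  set g : ℝ → ℝ := fun r => Real.sin r + r * Real.cos r with hg
  have cg : Continuous g := by fun_prop
  have h23 : Real.pi / 2 ≤ 2 * Real.pi / 3 := by linarith
  have ha : 0 ≤ g (Real.pi / 2) := by simp [hg]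
  have hb : g (2 * Real.pi / 3) ≤ 0 := by
    have e : 2 * Real.pi / 3 = Real.pi - Real.pi / 3 := by ring
    have h3 : Real.sqrt 3 ≤ 2 := by rw [Real.sqrt_le_left (by norm_num)]; norm_num
    simp only [hg]
    rw [e, Real.sin_pi_sub, Real.cos_pi_sub, Real.sin_pi_div_three, Real.cos_pi_div_three]
    linarith
  have hK : IsCompact (Icc (Real.pi / 2) (2 * Real.pi / 3) ∩ g ⁻¹' {0}) :=
    isCompact_Icc.inter_right (isClosed_singleton.preimage cg)
  have hne : (Icc (Real.pi / 2) (2 * Real.pi / 3) ∩ g ⁻¹' {0}).Nonempty := by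
    obtain ⟨r, hr, h0⟩ := intermediate_value_Icc' h23 cg.continuousOn ⟨hb, ha⟩
    exact ⟨r, hr, h0⟩
  obtain ⟨s, ⟨⟨hs1, hs2⟩, hs0⟩, hmin⟩ := hK.exists_isLeast hne
  refine ⟨s, by linarith, ?_, hs0, fun r hr h0 => ?_⟩
  · have h2 : Real.sqrt 2 < 3 / 2 := by rw [Real.sqrt_lt' (by norm_num)]; norm_num
    nlinarith
  · by_contra! hlt
    rcases lt_or_ge r (Real.pi / 2) with h | h
    · have h1 := Real.sin_pos_of_pos_of_lt_pi hr (by linarith)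
      have h2 := Real.cos_pos_of_mem_Ioo (x := r) ⟨by linarith, h⟩
      have := mul_pos hr h2
      linarith
    · exact hlt.not_ge (hmin ⟨⟨h, by linarith⟩, h0⟩)

section Extremal
variable {s : ℝ}

theorem integral_cos_eq (hs : 0 < s) (hroot : Real.sin s + s * Real.cos s = 0) :
    ∫ t in (0 : ℝ)..1, Real.cos (s * (2 * t - 1)) = -Real.cos s := by
  have hd : ∀ t ∈ uIcc (0 : ℝ) 1, HasDerivAt (fun t => Real.sin (s * (2 * t - 1)) / (2 * s))
      (Real.cos (s * (2 * t - 1))) t := by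
    intro t _
    have h : HasDerivAt (fun t : ℝ => s * (2 * t - 1)) (s * (2 * 1)) t :=
      (((hasDerivAt_id t).const_mul 2).sub_const 1).const_mul s
    refine (h.sin.div_const (2 * s)).congr_deriv ?_
    field_simp
  rw [intervalIntegral.integral_eq_sub_of_hasDerivAt hd
    (Continuous.intervalIntegrable (by fun_prop) _ _)]
  have e1 : s * (2 * 1 - 1) = s := by ring
  have e2 : s * (2 * 0 - 1) = -s := by ring
  rw [e1, e2, Real.sin_neg]
  field_simp
  linarith

theorem integral_cos_sq_eq (hs : 0 < s) (hroot : Real.sin s + s * Real.cos s = 0) :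
    ∫ t in (0 : ℝ)..1, Real.cos (s * (2 * t - 1)) ^ 2 = (1 - Real.cos s ^ 2) / 2 := by
  have hd : ∀ t ∈ uIcc (0 : ℝ) 1, HasDerivAt (fun t => t / 2 +
      Real.sin (s * (2 * t - 1)) * Real.cos (s * (2 * t - 1)) / (4 * s))
      (Real.cos (s * (2 * t - 1)) ^ 2) t := by
    intro t _
    have h : HasDerivAt (fun t : ℝ => s * (2 * t - 1)) (s * (2 * 1)) t :=
      (((hasDerivAt_id t).const_mul 2).sub_const 1).const_mul s
    refine (((hasDerivAt_id t).div_const 2).add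
      ((h.sin.mul h.cos).div_const (4 * s))).congr_deriv ?_
    field_simp
    linear_combination (-4) * Real.sin_sq_add_cos_sq (s * (2 * t - 1))
  rw [intervalIntegral.integral_eq_sub_of_hasDerivAt hd
    (Continuous.intervalIntegrable (by fun_prop) _ _)]
  have e1 : s * (2 * 1 - 1) = s := by ring
  have e2 : s * (2 * 0 - 1) = -s := by ring
  rw [e1, e2, Real.sin_neg, Real.cos_neg]
  field_simp
  linear_combination 4 * Real.cos s * hroot

/-- The function attaining the Poincaré constant of the triangle. -/
noncomputable def extremal (s : ℝ) (z : ℝ × ℝ) : ℝ :=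
  Real.cos (s * (2 * z.1 - 1)) + Real.cos (s * (2 * z.2 - 1))

theorem contDiff_extremal : ContDiff ℝ 1 (extremal s) := by
  unfold extremal; fun_prop

theorem gradient_extremal (z : ℝ × ℝ) :
    fderiv ℝ (extremal s) z (1, 0) ^ 2 + fderiv ℝ (extremal s) z (0, 1) ^ 2 =
      (2 * s) ^ 2 * (2 - (Real.cos (s * (2 * z.1 - 1)) ^ 2 +
        Real.cos (s * (2 * z.2 - 1)) ^ 2)) := by
  have hd : ∀ t : ℝ, HasDerivAt (fun t : ℝ => Real.cos (s * (2 * t - 1)))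
      (-Real.sin (s * (2 * t - 1)) * (s * (2 * 1))) t := fun t =>
    ((((hasDerivAt_id t).const_mul 2).sub_const 1).const_mul s).cos
  have h := ((hd z.1).comp_hasFDerivAt z (hasFDerivAt_fst (𝕜 := ℝ))).add
    ((hd z.2).comp_hasFDerivAt z (hasFDerivAt_snd (𝕜 := ℝ)))
  have h' : HasFDerivAt (extremal s) _ z := h
  rw [h'.fderiv]
  simp
  linear_combination (2 * s) ^ 2 * (Real.sin_sq_add_cos_sq (s * (2 * z.1 - 1)) +
    Real.sin_sq_add_cos_sq (s * (2 * z.2 - 1)))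

theorem integral_square_eq_two_mul {F : ℝ × ℝ → ℝ}
    (hF : Integrable F (unitMeasure.prod unitMeasure)) (hR : ∀ z, F (antiReflect z) = F z) :
    ∫ z, F z ∂(unitMeasure.prod unitMeasure) = 2 * ∫ z in triangle, F z := by
  rw [integral_square_eq hF, ← integral_const_mul]
  simp only [hR, two_mul]

theorem cos_antiReflect (t : ℝ) :
    Real.cos (s * (2 * (1 - t) - 1)) = Real.cos (s * (2 * t - 1)) := by
  rw [← Real.cos_neg]; ring_nf

theorem integral_extremal (hs : 0 < s) (hroot : Real.sin s + s * Real.cos s = 0) :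
    ∫ z in triangle, extremal s z ^ 2 = (1 + Real.cos s ^ 2) / 2 ∧
    ∫ z in triangle, (fderiv ℝ (extremal s) z (1, 0) ^ 2 +
      fderiv ℝ (extremal s) z (0, 1) ^ 2) = (2 * s) ^ 2 * ((1 + Real.cos s ^ 2) / 2) := by
  have p1 := integral_cos_eq hs hroot
  have p2 := integral_cos_sq_eq hs hroot
  rw [intervalIntegral_eq_unit] at p1 p2
  set φ : ℝ → ℝ := fun t => Real.cos (s * (2 * t - 1)) with hφ
  have cφ : Continuous φ := by fun_prop
  have bφ : ∀ t, |φ t| ≤ 1 := fun t => Real.abs_cos_le_one _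
  have bφ2 : ∀ t, |φ t ^ 2| ≤ 1 := fun t => by
    rw [abs_pow]; exact pow_le_one₀ (abs_nonneg _) (bφ t)
  have i1 : Integrable (fun z : ℝ × ℝ => φ z.1 ^ 2) (unitMeasure.prod unitMeasure) :=
    integrable_of_abs_le (by fun_prop) fun z => bφ2 z.1
  have i2 : Integrable (fun z : ℝ × ℝ => φ z.2 ^ 2) (unitMeasure.prod unitMeasure) :=
    integrable_of_abs_le (by fun_prop) fun z => bφ2 z.2
  have i3 : Integrable (fun z : ℝ × ℝ => φ z.1 * φ z.2) (unitMeasure.prod unitMeasure) :=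
    integrable_of_abs_le (M := 1) (by fun_prop) fun z => by
      rw [abs_mul]; exact mul_le_one₀ (bφ _) (abs_nonneg _) (bφ _)
  have i12 : Integrable (fun z : ℝ × ℝ => φ z.1 ^ 2 + φ z.2 ^ 2)
    (unitMeasure.prod unitMeasure) := i1.add i2
  have e1 : ∫ z : ℝ × ℝ, φ z.1 ^ 2 ∂(unitMeasure.prod unitMeasure) =
      (1 - Real.cos s ^ 2) / 2 := by
    rw [integral_fun_fst (fun t => φ t ^ 2), ← p2]; simp [hφ]
  have e2 : ∫ z : ℝ × ℝ, φ z.2 ^ 2 ∂(unitMeasure.prod unitMeasure) =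
      (1 - Real.cos s ^ 2) / 2 := by
    rw [integral_fun_snd (fun t => φ t ^ 2), ← p2]; simp [hφ]
  have e3 : ∫ z : ℝ × ℝ, φ z.1 * φ z.2 ∂(unitMeasure.prod unitMeasure) = Real.cos s ^ 2 := by
    rw [integral_prod_mul, show ∫ t, φ t ∂unitMeasure = -Real.cos s from p1]
    ring
  have hR : ∀ t, φ (1 - t) = φ t := cos_antiReflect
  have ev : ∀ z, extremal s z ^ 2 = (φ z.1 ^ 2 + φ z.2 ^ 2) + 2 * (φ z.1 * φ z.2) := fun z => by
    simp only [extremal, hφ]; ring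
  constructor
  · have h := integral_square_eq_two_mul (i12.add (i3.const_mul 2)) fun z => by
      simp only [Pi.add_apply, antiReflect, hR]; ring
    simp only [Pi.add_apply] at h
    rw [integral_add i12 (i3.const_mul 2), integral_add i1 i2, integral_const_mul, e1, e2, e3] at h
    simp only [ev]
    linarith
  · have h := integral_square_eq_two_mul
      (((integrable_const (2 : ℝ)).sub i12).const_mul ((2 * s) ^ 2)) fun z => by
        simp only [Pi.sub_apply, antiReflect, hR]; ring
    simp only [Pi.sub_apply] at h
    rw [integral_const_mul, integral_sub (integrable_const _) i12, integral_add i1 i2, e1, e2] at h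
    simp only [gradient_extremal]
    simp only [integral_const, probReal_univ, one_smul] at h
    linarith

theorem integral_extremal_leg_fst (hs : 0 < s) (hroot : Real.sin s + s * Real.cos s = 0) :
    ∫ t in (0 : ℝ)..1, extremal s (t, 0) = 0 := by
  have i : IntervalIntegrable (fun t : ℝ => Real.cos (s * (2 * t - 1))) volume 0 1 :=
    Continuous.intervalIntegrable (by fun_prop) _ _
  simp only [extremal]
  rw [intervalIntegral.integral_add i (by simp), integral_cos_eq hs hroot]
  simp

theorem integral_extremal_leg_snd (hs : 0 < s) (hroot : Real.sin s + s * Real.cos s = 0) :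
    ∫ t in (0 : ℝ)..1, extremal s (0, t) = 0 := by
  simpa only [extremal, add_comm] using integral_extremal_leg_fst hs hroot

end Extremal
end TriangleConstant

/-- On the unit right isosceles triangle `T`, the supremum of `‖v‖/|v|₁` over
functions `v` that are `C¹` near `T`, have vanishing mean on the two legs, and have
`|v|₁ > 0`, equals the greatest element of the set of positive solutions of
`sin(1/(2μ)) + (1/(2μ))·cos(1/(2μ)) = 0`. -/
theorem stmt_17
    (T : Set (ℝ × ℝ))
    (hT : T = convexHull ℝ {((0 : ℝ), (0 : ℝ)), (1, 0), (0, 1)}) :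
    ∃ μs : ℝ,
      IsGreatest {μ : ℝ | 0 < μ ∧
        Real.sin (1 / (2 * μ)) + (1 / (2 * μ)) * Real.cos (1 / (2 * μ)) = 0} μs ∧
      sSup {r : ℝ | ∃ v : ℝ × ℝ → ℝ,
        (∃ U : Set (ℝ × ℝ), IsOpen U ∧ T ⊆ U ∧ ContDiffOn ℝ 1 v U) ∧
        (∫ t in (0:ℝ)..1, v (t, 0)) = 0 ∧
        (∫ t in (0:ℝ)..1, v (0, t)) = 0 ∧
        (0 < ∫ x in T, ((fderiv ℝ v x (1, 0)) ^ 2 + (fderiv ℝ v x (0, 1)) ^ 2)) ∧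
        r = Real.sqrt (∫ x in T, (v x) ^ 2) /
          Real.sqrt (∫ x in T, ((fderiv ℝ v x (1, 0)) ^ 2 + (fderiv ℝ v x (0, 1)) ^ 2))} = μs := by
  have hT' : T = TriangleConstant.triangle := hT.trans TriangleConstant.convexHull_eq_triangle
  subst hT'
  obtain ⟨s, hs, hsπ, hroot, hmin⟩ := TriangleConstant.exists_least_root
  refine ⟨1 / (2 * s), ⟨⟨by positivity, ?_⟩, ?_⟩, ?_⟩
  · have e : 1 / (2 * (1 / (2 * s))) = s := by field_simp
    rw [e]
    exact hroot
  · rintro μ ⟨hμ, h⟩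
    have := hmin _ (by positivity) h
    rw [le_div_iff₀ (by positivity)] at this ⊢
    linarith
  · refine IsGreatest.csSup_eq ⟨⟨TriangleConstant.extremal s, ?_, ?_, ?_, ?_, ?_⟩, ?_⟩
    · exact ⟨Set.univ, isOpen_univ, Set.subset_univ _,
        TriangleConstant.contDiff_extremal.contDiffOn⟩
    · exact TriangleConstant.integral_extremal_leg_fst hs hroot
    · exact TriangleConstant.integral_extremal_leg_snd hs hroot
    · rw [(TriangleConstant.integral_extremal hs hroot).2]
      positivity
    · rw [(TriangleConstant.integral_extremal hs hroot).1,
        (TriangleConstant.integral_extremal hs hroot).2, Real.sqrt_mul (by positivity),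
        Real.sqrt_sq (by positivity)]
      have : 0 < Real.sqrt ((1 + Real.cos s ^ 2) / 2) := by positivity
      field_simp
    · rintro r ⟨v, ⟨U, hU, hTU, hv⟩, h0, h1, hpos, rfl⟩
      have key := Real.sqrt_le_sqrt
        (TriangleConstant.triangle_inequality hs hsπ hroot hU hTU hv h0 h1)
      rw [Real.sqrt_mul (by positivity), Real.sqrt_sq (by positivity)] at key
      rw [div_le_div_iff₀ (Real.sqrt_pos.2 hpos) (by positivity)]
      linarith
end
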